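/- arXiv:1407.1750 — 2 statements merged into one kernel-verified Lean document; each statement's English description precedes it below -/
import Mathlib

section
/- Let A be a unital associative superalgebra over a commutative unital ring K which is perfect as a Lie superalgebra (A = [A,A] with [a,b] = ab − (−1)^{|a||b|}ba). Then there is a short exact sequence 0 → H̄₁(A, V(A)) → H₂(A) → HC₁(A) → 0, where H₂(A) is the second homology of the Lie superalgebra A with trivial coefficients K. If in addition H₂(A) = 0, then all six terms of the sequence (A/[A,A]) ⊗_K HC₁(A) → H̄₁(A,V(A)) → H̄₁(A,[A,A]) → HC₁(A) → HC₁^M(A) → [A,A]/[A,[A,A]] → 0 are trivial. -/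
open scoped TensorProduct

namespace SuperNA

/-- The sign `(-1)^(|α||β|)` appearing in super-algebra identities. -/
def ssign (α β : ZMod 2) : ℤ := (-1 : ℤ) ^ (α.val * β.val)

/-- A Lie superalgebra over a commutative unital ring `K`: a `ℤ/2`-graded `K`-module
with a bilinear bracket satisfying the graded skew-symmetry, the graded Jacobi
(Leibniz form) identity, and `[x₀,x₀] = 0` for even `x₀`. -/
structure LieSuperalgebra (K : Type) [CommRing K] : Type 1 where
  carrier : Type
  [isAddCommGroup : AddCommGroup carrier]
  [isModule : Module K carrier]
  grading : ZMod 2 → Submodule K carrier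
  isInternal : DirectSum.IsInternal grading
  bracket : carrier →ₗ[K] carrier →ₗ[K] carrier
  bracket_grading : ∀ (α β : ZMod 2) (x y : carrier),
    x ∈ grading α → y ∈ grading β → bracket x y ∈ grading (α + β)
  super_skew : ∀ (α β : ZMod 2) (x y : carrier), x ∈ grading α → y ∈ grading β →
    bracket x y = -(ssign α β • bracket y x)
  super_jacobi : ∀ (α β : ZMod 2) (x y : carrier), x ∈ grading α → y ∈ grading β →
    ∀ z : carrier, bracket x (bracket y z)
      = bracket (bracket x y) z + ssign α β • bracket y (bracket x z)
  bracket_self_even : ∀ x ∈ grading 0, bracket x x = 0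

attribute [instance] LieSuperalgebra.isAddCommGroup LieSuperalgebra.isModule

variable {K : Type} [CommRing K]

instance : CoeSort (LieSuperalgebra K) Type := ⟨LieSuperalgebra.carrier⟩

/-- A homomorphism of Lie superalgebras: an even linear map preserving brackets. -/
structure LieSuperHom (L M : LieSuperalgebra K) where
  toLinear : L.carrier →ₗ[K] M.carrier
  map_grading : ∀ (α : ZMod 2), ∀ x ∈ L.grading α, toLinear x ∈ M.grading α
  map_bracket : ∀ x y, toLinear (L.bracket x y) = M.bracket (toLinear x) (toLinear y)

/-- An action of the Lie superalgebra `P` on the Lie superalgebra `M`. -/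
structure LieSuperAction (P M : LieSuperalgebra K) where
  act : P.carrier →ₗ[K] M.carrier →ₗ[K] M.carrier
  act_grading : ∀ (α β : ZMod 2) (p : P.carrier) (m : M.carrier),
    p ∈ P.grading α → m ∈ M.grading β → act p m ∈ M.grading (α + β)
  act_bracket : ∀ (α β : ZMod 2) (p p' : P.carrier), p ∈ P.grading α → p' ∈ P.grading β →
    ∀ m : M.carrier, act (P.bracket p p') m = act p (act p' m) - ssign α β • act p' (act p m)
  act_super_der : ∀ (α β : ZMod 2) (p : P.carrier) (m : M.carrier),
    p ∈ P.grading α → m ∈ M.grading β → ∀ m' : M.carrier,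
    act p (M.bracket m m') = M.bracket (act p m) m' + ssign α β • M.bracket m (act p m')

/-- Two mutual actions are compatible. -/
structure AreCompatible {M N : LieSuperalgebra K}
    (aMN : LieSuperAction M N) (aNM : LieSuperAction N M) : Prop where
  compat_left : ∀ (α β : ZMod 2) (m : M.carrier) (n : N.carrier),
    m ∈ M.grading α → n ∈ N.grading β → ∀ n' : N.carrier,
    aMN.act (aNM.act n m) n' = -(ssign α β • N.bracket (aMN.act m n) n')
  compat_right : ∀ (α β : ZMod 2) (m : M.carrier) (n : N.carrier),
    m ∈ M.grading α → n ∈ N.grading β → ∀ m' : M.carrier,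
    aNM.act (aMN.act m n) m' = -(ssign α β • M.bracket (aNM.act n m) m')

/-- A crossed module of Lie superalgebras `∂ : M → P`. -/
structure CrossedModule (M P : LieSuperalgebra K) where
  act : LieSuperAction P M
  d : LieSuperHom M P
  cm_act : ∀ (p : P.carrier) (m : M.carrier), d.toLinear (act.act p m) = P.bracket p (d.toLinear m)
  cm_peiffer : ∀ (m m' : M.carrier), act.act (d.toLinear m) m' = M.bracket m m'

/-- A morphism of crossed `P`-modules. -/
structure CMHom {P M N : LieSuperalgebra K} (cmM : CrossedModule M P) (cmN : CrossedModule N P) where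
  hom : LieSuperHom M N
  equivariant : ∀ (p : P.carrier) (m : M.carrier),
    hom.toLinear (cmM.act.act p m) = cmN.act.act p (hom.toLinear m)
  comm : ∀ m : M.carrier, cmN.d.toLinear (hom.toLinear m) = cmM.d.toLinear m

/-- The data of a family of "tensor symbols" in a Lie superalgebra `Q`, indexed by pairs of
homogeneous elements of `M` and `N`, satisfying the defining relations of the non-abelian
tensor product `M ⊗ N`. -/
structure TensorData {M N : LieSuperalgebra K}
    (aMN : LieSuperAction M N) (aNM : LieSuperAction N M) (Q : LieSuperalgebra K) where
  pair : (α β : ZMod 2) → M.grading α → N.grading β → Q.carrier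
  pair_grading : ∀ (α β : ZMod 2) (m : M.grading α) (n : N.grading β),
    pair α β m n ∈ Q.grading (α + β)
  pair_smul_left : ∀ (α β : ZMod 2) (c : K) (m : M.grading α) (n : N.grading β),
    pair α β (c • m) n = c • pair α β m n
  pair_smul_right : ∀ (α β : ZMod 2) (c : K) (m : M.grading α) (n : N.grading β),
    pair α β m (c • n) = c • pair α β m n
  pair_add_left : ∀ (α β : ZMod 2) (m m' : M.grading α) (n : N.grading β),
    pair α β (m + m') n = pair α β m n + pair α β m' n
  pair_add_right : ∀ (α β : ZMod 2) (m : M.grading α) (n n' : N.grading β),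
    pair α β m (n + n') = pair α β m n + pair α β m n'
  pair_bracket_left : ∀ (α α' β : ZMod 2) (m : M.grading α) (m' : M.grading α') (n : N.grading β),
    pair (α + α') β ⟨M.bracket m.1 m'.1, M.bracket_grading α α' m.1 m'.1 m.2 m'.2⟩ n
      = pair α (α' + β) m ⟨aMN.act m'.1 n.1, aMN.act_grading α' β m'.1 n.1 m'.2 n.2⟩
        - ssign α α' • pair α' (α + β) m' ⟨aMN.act m.1 n.1, aMN.act_grading α β m.1 n.1 m.2 n.2⟩
  pair_bracket_right : ∀ (α β β' : ZMod 2) (m : M.grading α) (n : N.grading β) (n' : N.grading β'),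
    pair α (β + β') m ⟨N.bracket n.1 n'.1, N.bracket_grading β β' n.1 n'.1 n.2 n'.2⟩
      = ssign β' (α + β) • pair (β' + α) β
          ⟨aNM.act n'.1 m.1, aNM.act_grading β' α n'.1 m.1 n'.2 m.2⟩ n
        - ssign α β • pair (β + α) β'
          ⟨aNM.act n.1 m.1, aNM.act_grading β α n.1 m.1 n.2 m.2⟩ n'
  pair_bracket_pair : ∀ (α β α' β' : ZMod 2) (m : M.grading α) (n : N.grading β)
      (m' : M.grading α') (n' : N.grading β'),
    Q.bracket (pair α β m n) (pair α' β' m' n')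
      = -(ssign α β • pair (β + α) (α' + β')
          ⟨aNM.act n.1 m.1, aNM.act_grading β α n.1 m.1 n.2 m.2⟩
          ⟨aMN.act m'.1 n'.1, aMN.act_grading α' β' m'.1 n'.1 m'.2 n'.2⟩)

/-- `(T, ι)` is *the* non-abelian tensor product `M ⊗ N`: it is initial among Lie
superalgebras equipped with tensor symbols satisfying the defining relations.  This
universal property characterizes the Lie superalgebra presented by the generators
`m ⊗ n` and the relations of the non-abelian tensor product, uniquely up to isomorphism. -/
def IsNATensor {M N : LieSuperalgebra K} (aMN : LieSuperAction M N) (aNM : LieSuperAction N M)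
    (T : LieSuperalgebra K) (ι : TensorData aMN aNM T) : Prop :=
  ∀ (Q : LieSuperalgebra K) (d : TensorData aMN aNM Q),
    ∃! f : LieSuperHom T Q,
      ∀ (α β : ZMod 2) (m : M.grading α) (n : N.grading β),
        f.toLinear (ι.pair α β m n) = d.pair α β m n

/-- Tensor-symbol data additionally satisfying the relations of the non-abelian
exterior square `L ∧ L` (relative to an action `a` of `L` on itself). -/
structure ExtSqData {L : LieSuperalgebra K} (a : LieSuperAction L L) (Q : LieSuperalgebra K)
    extends TensorData a a Q where
  pair_alt : ∀ (α β : ZMod 2) (x : L.grading α) (y : L.grading β),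
    toTensorData.pair α β x y + ssign α β • toTensorData.pair β α y x = 0
  pair_self : ∀ x : L.grading 0, toTensorData.pair 0 0 x x = 0

/-- `(E, ι)` is the non-abelian exterior square `L ∧ L`. -/
def IsNAExtSq {L : LieSuperalgebra K} (a : LieSuperAction L L) (E : LieSuperalgebra K)
    (ι : ExtSqData a E) : Prop :=
  ∀ (Q : LieSuperalgebra K) (d : ExtSqData a Q),
    ∃! f : LieSuperHom E Q,
      ∀ (α β : ZMod 2) (x : L.grading α) (y : L.grading β),
        f.toLinear (ι.pair α β x y) = d.pair α β x y

/-- Generating family for a free Lie superalgebra on a graded set. -/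
structure FreeData (X : Type) (degX : X → ZMod 2) (F : LieSuperalgebra K) where
  gen : X → F.carrier
  gen_grading : ∀ x, gen x ∈ F.grading (degX x)

/-- `F` (with generators `i`) is the free Lie superalgebra on the graded set `(X, degX)`. -/
def IsFreeLieSuper {X : Type} (degX : X → ZMod 2) (F : LieSuperalgebra K)
    (i : FreeData X degX F) : Prop :=
  ∀ (M : LieSuperalgebra K) (j : FreeData X degX M),
    ∃! h : LieSuperHom F M, ∀ x, h.toLinear (i.gen x) = j.gen x

/-- The submodule spanned by brackets `[S, T]`. -/
def bracketSpan (L : LieSuperalgebra K) (S T : Submodule K L.carrier) :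
    Submodule K L.carrier :=
  Submodule.span K {z | ∃ x ∈ S, ∃ y ∈ T, z = L.bracket x y}

/-- Lower central series of a (sub-)Lie superalgebra `S ⊆ L`: `lcs 0 = S`,
`lcs (n+1) = [S, lcs n]`.  `S` is nilpotent of class `≤ c` iff `lcs c = ⊥`. -/
def lcs (L : LieSuperalgebra K) (S : Submodule K L.carrier) : ℕ → Submodule K L.carrier
  | 0 => S
  | n + 1 => bracketSpan L S (lcs L S n)

/-- Derived series of `S ⊆ L`.  `S` is solvable of derived length `≤ c` iff `ds c = ⊥`. -/
def ds (L : LieSuperalgebra K) (S : Submodule K L.carrier) : ℕ → Submodule K L.carrier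
  | 0 => S
  | n + 1 => bracketSpan L (ds L S n) (ds L S n)

/-- `S ⊆ L` is `n`-Engel: `ad(x)ⁿ = 0` on `S` for every `x ∈ S`. -/
def IsEngel (L : LieSuperalgebra K) (S : Submodule K L.carrier) (n : ℕ) : Prop :=
  ∀ x ∈ S, ∀ y ∈ S, ((L.bracket x) ^ n) y = 0

section Grading

variable {V W : Type} [AddCommGroup V] [Module K V] [AddCommGroup W] [Module K W]

/-- The induced grading on a submodule. -/
def gradeSub (g : ZMod 2 → Submodule K V) (S : Submodule K V) : ZMod 2 → Submodule K S :=
  fun α => (g α).comap S.subtype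

/-- The induced grading on a quotient module. -/
def gradeQuot (g : ZMod 2 → Submodule K V) (S : Submodule K V) : ZMod 2 → Submodule K (V ⧸ S) :=
  fun α => (g α).map S.mkQ

/-- The induced grading on a tensor product of supermodules. -/
def gradeTensor (gV : ZMod 2 → Submodule K V) (gW : ZMod 2 → Submodule K W) :
    ZMod 2 → Submodule K (V ⊗[K] W) :=
  fun γ => Submodule.span K {t | ∃ (α β : ZMod 2) (v : V) (w : W),
    α + β = γ ∧ v ∈ gV α ∧ w ∈ gW β ∧ t = v ⊗ₜ[K] w}

/-- A linear equivalence is an isomorphism of supermodules for the given gradings. -/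
def SuperEquiv (gV : ZMod 2 → Submodule K V) (gW : ZMod 2 → Submodule K W)
    (e : V ≃ₗ[K] W) : Prop :=
  ∀ α, (gV α).map e.toLinearMap = gW α

end Grading

/-- An associative (unital) superalgebra over `K`. -/
structure AssocSuperalgebra (K : Type) [CommRing K] : Type 1 where
  carrier : Type
  [isRing : Ring carrier]
  [isAlgebra : Algebra K carrier]
  grading : ZMod 2 → Submodule K carrier
  isInternal : DirectSum.IsInternal grading
  grading_mul : ∀ (α β : ZMod 2) (x y : carrier),
    x ∈ grading α → y ∈ grading β → x * y ∈ grading (α + β)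
  one_mem : (1 : carrier) ∈ grading 0

attribute [instance] AssocSuperalgebra.isRing AssocSuperalgebra.isAlgebra

/-- A (not necessarily unital) associative superalgebra over `K`. -/
structure NuAssocSuperalgebra (K : Type) [CommRing K] : Type 1 where
  carrier : Type
  [isRing : NonUnitalRing carrier]
  [isModule : Module K carrier]
  [isTower : IsScalarTower K carrier carrier]
  [isComm : SMulCommClass K carrier carrier]
  grading : ZMod 2 → Submodule K carrier
  isInternal : DirectSum.IsInternal grading
  grading_mul : ∀ (α β : ZMod 2) (x y : carrier),
    x ∈ grading α → y ∈ grading β → x * y ∈ grading (α + β)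

attribute [instance] NuAssocSuperalgebra.isRing NuAssocSuperalgebra.isModule
  NuAssocSuperalgebra.isTower NuAssocSuperalgebra.isComm

/-- The super-alternating relations inside `L ⊗ L`, whose quotient is `Λ²(L)`. -/
def altRel (L : LieSuperalgebra K) : Submodule K (L.carrier ⊗[K] L.carrier) :=
  Submodule.span K {t | ∃ (α β : ZMod 2) (x : L.grading α) (y : L.grading β),
    t = x.1 ⊗ₜ[K] y.1 + ssign α β • (y.1 ⊗ₜ[K] x.1)}

/-- The super-alternating relations inside `L ⊗ (L ⊗ L)`, whose quotient is `Λ³(L)`. -/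
def altRel3 (L : LieSuperalgebra K) :
    Submodule K (L.carrier ⊗[K] (L.carrier ⊗[K] L.carrier)) :=
  Submodule.span K
    ({t | ∃ (x : L.carrier) (r : L.carrier ⊗[K] L.carrier), r ∈ altRel L ∧ t = x ⊗ₜ[K] r} ∪
     {t | ∃ (α β : ZMod 2) (x : L.grading α) (y : L.grading β) (z : L.carrier),
        t = x.1 ⊗ₜ[K] (y.1 ⊗ₜ[K] z) + ssign α β • (y.1 ⊗ₜ[K] (x.1 ⊗ₜ[K] z))})


/-- The graded submodule `I(A) ⊆ A ⊗_K A` of the cyclic relations. -/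
def IA {K : Type} [CommRing K] (A : NuAssocSuperalgebra K) :
    Submodule K (A.carrier ⊗[K] A.carrier) :=
  Submodule.span K
    ({t | ∃ (α β : ZMod 2) (a : A.grading α) (b : A.grading β),
        t = a.1 ⊗ₜ[K] b.1 + ssign α β • (b.1 ⊗ₜ[K] a.1)} ∪
     {t | ∃ (α β γ : ZMod 2) (a : A.grading α) (b : A.grading β) (c : A.grading γ),
        t = (a.1 * b.1) ⊗ₜ[K] c.1 - a.1 ⊗ₜ[K] (b.1 * c.1)
            + ssign γ (α + β) • ((c.1 * a.1) ⊗ₜ[K] b.1)})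

/-- The graded submodule `J(A) ⊆ A ⊗_K A` of the Milnor relations, whose quotient is the
first Milnor cyclic homology `HC₁^M(A)`. -/
def JA {K : Type} [CommRing K] (A : NuAssocSuperalgebra K) :
    Submodule K (A.carrier ⊗[K] A.carrier) :=
  Submodule.span K
    ({t | ∃ (α β : ZMod 2) (a : A.grading α) (b : A.grading β),
        t = a.1 ⊗ₜ[K] b.1 + ssign α β • (b.1 ⊗ₜ[K] a.1)} ∪
     {t | ∃ (α β γ : ZMod 2) (a : A.grading α) (b : A.grading β) (c : A.grading γ),
        t = (a.1 * b.1) ⊗ₜ[K] c.1 - a.1 ⊗ₜ[K] (b.1 * c.1)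
            + ssign γ (α + β) • ((c.1 * a.1) ⊗ₜ[K] b.1)} ∪
     {t | ∃ (α β γ : ZMod 2) (a : A.grading α) (b : A.grading β) (c : A.grading γ),
        t = a.1 ⊗ₜ[K] (b.1 * c.1) - ssign β γ • (a.1 ⊗ₜ[K] (c.1 * b.1))})

/-- `[A,A]`: the graded submodule generated by the super-commutators. -/
def commSpan {K : Type} [CommRing K] (A : NuAssocSuperalgebra K) : Submodule K A.carrier :=
  Submodule.span K {x | ∃ (α β : ZMod 2) (a : A.grading α) (b : A.grading β),
    x = a.1 * b.1 - ssign α β • (b.1 * a.1)}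

/-- `[A,[A,A]]`. -/
def commSpan2 {K : Type} [CommRing K] (A : NuAssocSuperalgebra K)
    (brA : A.carrier →ₗ[K] A.carrier →ₗ[K] A.carrier) : Submodule K A.carrier :=
  Submodule.span K {x | ∃ (a : A.carrier), ∃ y ∈ commSpan A, x = brA a y}

/-- A unital associative superalgebra is in particular a possibly-non-unital one. -/
def AssocSuperalgebra.toNu {K : Type} [CommRing K] (A : AssocSuperalgebra K) :
    NuAssocSuperalgebra K where
  carrier := A.carrier
  grading := A.grading
  isInternal := A.isInternal
  grading_mul := A.grading_mul


theorem ssign_mul_self (α β : ZMod 2) : ssign α β * ssign α β = 1 := by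
  revert α β; decide

theorem ssign_comm (α β : ZMod 2) : ssign α β = ssign β α := by
  revert α β; decide

theorem ssign_add_left (α β γ : ZMod 2) : ssign (α + β) γ = ssign α γ * ssign β γ := by
  revert α β γ; decide

theorem ssign_add_right (α β γ : ZMod 2) : ssign α (β + γ) = ssign α β * ssign α γ := by
  revert α β γ; decide

theorem ssign_zero_left (α : ZMod 2) : ssign 0 α = 1 := by
  revert α; decide

theorem ssign_zero_right (α : ZMod 2) : ssign α 0 = 1 := by
  revert α; decide

theorem ssign_eq_one_or (α β : ZMod 2) : ssign α β = 1 ∨ ssign α β = -1 := by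
  revert α β; decide

theorem ssign_smul_smul {V : Type*} [AddCommGroup V] (α β : ZMod 2) (v : V) :
    ssign α β • ssign α β • v = v := by
  rw [smul_smul, ssign_mul_self, one_smul]

/-- The supercommutators of homogeneous elements of total degree `γ`. -/
def superComms {B : Type*} [Ring B] [Algebra K B] (𝓑 : ZMod 2 → Submodule K B) (γ : ZMod 2) :
    Set B :=
  {x | ∃ α β a b, a ∈ 𝓑 α ∧ b ∈ 𝓑 β ∧ α + β = γ ∧ x = a * b - ssign α β • (b * a)}

section FreeTriple

variable {B V : Type*} [Ring B] [Algebra K B] [AddCommGroup V] [Module K V]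

/-- A `ℤ/2`-graded unital algebra (without directness of the grading) all of whose homogeneous
elements are sums of supercommutators. -/
structure IsPerfectGrading (𝓑 : ZMod 2 → Submodule K B) : Prop where
  one_mem : 1 ∈ 𝓑 0
  mul_mem : ∀ {α β : ZMod 2} {a b : B}, a ∈ 𝓑 α → b ∈ 𝓑 β → a * b ∈ 𝓑 (α + β)
  span : ∀ γ, 𝓑 γ ≤ Submodule.span K (superComms 𝓑 γ)
  sup : ∀ x : B, ∃ a ∈ 𝓑 0, ∃ b ∈ 𝓑 1, x = a + b

/-- Two linear families of operators that supercommute on homogeneous arguments. -/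
def SuperCommute (𝓑 : ZMod 2 → Submodule K B) (ρ σ : B →ₗ[K] Module.End K V) : Prop :=
  ∀ ⦃α β : ZMod 2⦄ ⦃a b : B⦄, a ∈ 𝓑 α → b ∈ 𝓑 β → ∀ v : V,
    ρ a (σ b v) = ssign α β • σ b (ρ a v)

theorem SuperCommute.symm {𝓑 : ZMod 2 → Submodule K B} {ρ σ : B →ₗ[K] Module.End K V}
    (h : SuperCommute 𝓑 ρ σ) : SuperCommute 𝓑 σ ρ := by
  intro α β a b ha hb v
  rw [h hb ha, ssign_comm, ssign_smul_smul]

theorem IsPerfectGrading.induction {𝓑 : ZMod 2 → Submodule K B} (h𝓑 : IsPerfectGrading 𝓑)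
    {W : Type*} [AddCommGroup W] [Module K W] {γ : ZMod 2} (S : Submodule K W) (f : B →ₗ[K] W)
    (hf : ∀ α β a b, a ∈ 𝓑 α → b ∈ 𝓑 β → α + β = γ → f (a * b - ssign α β • (b * a)) ∈ S)
    {x : B} (hx : x ∈ 𝓑 γ) : f x ∈ S := by
  have : Submodule.span K (superComms 𝓑 γ) ≤ S.comap f := by
    rw [Submodule.span_le]
    rintro _ ⟨α, β, a, b, ha, hb, hab, rfl⟩
    exact hf α β a b ha hb hab
  exact this (h𝓑.span γ hx)

theorem supercomm_apply_of_triple_relation {𝓑 : ZMod 2 → Submodule K B}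
    {ρ₁ ρ₂ ρ₃ : B →ₗ[K] Module.End K V} (one₁ : ρ₁ 1 = 1) (one₂ : ρ₂ 1 = 1) (one₃ : ρ₃ 1 = 1)
    (mul₁ : ∀ a b, ρ₁ (a * b) = ρ₁ a * ρ₁ b) (mul₂ : ∀ a b, ρ₂ (a * b) = ρ₂ a * ρ₂ b)
    (c₁₂ : SuperCommute 𝓑 ρ₁ ρ₂) {α β : ZMod 2} {x y : B} (hx : x ∈ 𝓑 α) (hy : y ∈ 𝓑 β)
    {w₁ w₂ w₃ : V} (hw : ∀ a, ρ₁ a w₁ + ρ₂ a w₂ + ρ₃ a w₃ = 0) :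
    ρ₁ (x * y - ssign α β • (y * x)) w₁ + ρ₁ x (ρ₃ y w₃) - ρ₁ x (ρ₂ y w₃)
      + ssign α β • ρ₂ y (ρ₃ x w₃) - ssign α β • ρ₃ (y * x) w₃ = 0 := by
  have h1 := congrArg (ρ₁ x) (hw y)
  have h2 := congrArg (fun t => ρ₁ x (ρ₂ y t)) (hw 1)
  have h3 := congrArg (ρ₂ y) (hw x)
  have h4 := hw (y * x)
  simp only [one₁, one₂, one₃, map_add, map_zero, Module.End.one_apply] at h1 h2 h3
  rw [c₁₂.symm hy hx, ssign_comm] at h3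
  simp only [map_sub, map_zsmul, LinearMap.sub_apply, LinearMap.smul_apply, mul₁, mul₂,
    Module.End.mul_apply] at *
  linear_combination (norm := module) h1 - h2 + ssign α β • h3 - ssign α β • h4
    + (ssign_mul_self α β) • (-ρ₁ x (ρ₂ y w₁))

/-- Three pairwise supercommuting representations of a perfect superalgebra satisfy no
nontrivial linear relation. -/
theorem eq_zero_of_triple_relation {𝓑 : ZMod 2 → Submodule K B} (h𝓑 : IsPerfectGrading 𝓑)
    {ρ₁ ρ₂ ρ₃ : B →ₗ[K] Module.End K V}
    (one₁ : ρ₁ 1 = 1) (one₂ : ρ₂ 1 = 1) (one₃ : ρ₃ 1 = 1)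
    (mul₁ : ∀ a b, ρ₁ (a * b) = ρ₁ a * ρ₁ b) (mul₂ : ∀ a b, ρ₂ (a * b) = ρ₂ a * ρ₂ b)
    (mul₃ : ∀ a b, ρ₃ (a * b) = ρ₃ a * ρ₃ b)
    (c₁₂ : SuperCommute 𝓑 ρ₁ ρ₂) (c₁₃ : SuperCommute 𝓑 ρ₁ ρ₃) (c₂₃ : SuperCommute 𝓑 ρ₂ ρ₃)
    {v₁ v₂ v₃ : V} (hv : ∀ a, ρ₁ a v₁ + ρ₂ a v₂ + ρ₃ a v₃ = 0) : v₃ = 0 := by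
  have c₂₁ := c₁₂.symm
  have c₃₁ := c₁₃.symm
  have c₃₂ := c₂₃.symm
  have E : ∀ {α β : ZMod 2} {x y : B}, x ∈ 𝓑 α → y ∈ 𝓑 β → ∀ {w₁ w₂ w₃ : V},
      (∀ a, ρ₁ a w₁ + ρ₂ a w₂ + ρ₃ a w₃ = 0) →
      ρ₁ x (ρ₂ y w₃) + ρ₂ x (ρ₁ y w₃) = (ρ₁ + ρ₂) x (ρ₃ y w₃)
        + ssign α β • (ρ₁ + ρ₂) y (ρ₃ x w₃) - ρ₃ (x * y + ssign α β • (y * x)) w₃ := by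
    intro α β x y hx hy w₁ w₂ w₃ hw
    have h1 := supercomm_apply_of_triple_relation one₁ one₂ one₃ mul₁ mul₂ c₁₂ hx hy hw
    have h2 := supercomm_apply_of_triple_relation one₂ one₁ one₃ mul₂ mul₁ c₂₁ hx hy
      (w₁ := w₂) (w₂ := w₁) (w₃ := w₃) (fun a => by rw [← hw a]; abel)
    have h3 := hw (x * y - ssign α β • (y * x))
    simp only [map_sub, map_add, map_zsmul, LinearMap.sub_apply, LinearMap.add_apply,
      LinearMap.smul_apply] at *
    linear_combination (norm := module) h3 - h1 - h2
  obtain ⟨P, hP⟩ : ∃ P : B →ₗ[K] V, ∀ u, P u = ρ₃ u v₃ := ⟨ρ₃.flip v₃, fun _ => rfl⟩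
  have hPmul : ∀ d u, ρ₃ d (P u) = P (d * u) := fun d u => by
    rw [hP, hP, mul₃, Module.End.mul_apply]
  obtain ⟨β', hβ'⟩ : ∃ β' : B →ₗ[K] Module.End K V, β' = ρ₁ + ρ₂ := ⟨_, rfl⟩
  have cβ : SuperCommute 𝓑 ρ₃ β' := by
    intro α β a b ha hb v
    simp only [hβ', LinearMap.add_apply, map_add, c₃₁ ha hb, c₃₂ ha hb, smul_add]
  have EP : ∀ {α β : ZMod 2} {x y : B}, x ∈ 𝓑 α → y ∈ 𝓑 β → ∀ c,
      ρ₁ x (ρ₂ y (P c)) + ρ₂ x (ρ₁ y (P c)) = β' x (P (y * c))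
        + ssign α β • β' y (P (x * c)) - P ((x * y + ssign α β • (y * x)) * c) := by
    intro α β x y hx hy c
    have := E hx hy (w₁ := ρ₁ c v₁) (w₂ := ρ₂ c v₂) (w₃ := ρ₃ c v₃) (fun a => by
      rw [← hv (a * c), mul₁, mul₂, mul₃]; rfl)
    rwa [← hP, hPmul, hPmul, hPmul, ← hβ'] at this
  have F : ∀ {α β τ : ZMod 2} {x y t : B}, x ∈ 𝓑 α → y ∈ 𝓑 β → t ∈ 𝓑 τ → ∀ c,
      β' x (P ((y * t - ssign β τ • (t * y)) * c))
        + ssign α β • β' y (P ((x * t - ssign α τ • (t * x)) * c))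
        = P (((x * y + ssign α β • (y * x)) * t
          - (ssign α τ * ssign β τ) • (t * (x * y + ssign α β • (y * x)))) * c) := by
    intro α β τ x y t hx hy ht c
    have h1 := congrArg (ρ₃ t) (EP hx hy c)
    have h2 := EP hx hy (t * c)
    simp only [map_add, map_sub, map_zsmul, c₃₁ ht hx, c₃₂ ht hx, c₃₁ ht hy, c₃₂ ht hy,
      cβ ht hx, cβ ht hy, hPmul, ssign_comm τ] at h1
    simp only [add_mul, sub_mul, mul_add, smul_mul_assoc, mul_smul_comm, mul_assoc,
      map_add, map_sub, map_zsmul, smul_add, smul_sub] at h1 h2 ⊢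
    rcases ssign_eq_one_or α τ with h | h <;> rcases ssign_eq_one_or β τ with h' | h' <;>
    simp only [h, h'] at h1 h2 ⊢ <;>
    [linear_combination (norm := module) h1 - h2; linear_combination (norm := module) -h1 - h2;
      linear_combination (norm := module) -h1 - h2; linear_combination (norm := module) h1 - h2]
  have Fl : ∀ {α β τ δ : ZMod 2} {x y t d : B}, x ∈ 𝓑 α → y ∈ 𝓑 β → t ∈ 𝓑 τ → d ∈ 𝓑 δ → ∀ c,
      β' x (P (d * (y * t - ssign β τ • (t * y)) * c))
        + (ssign α β * ssign α δ * ssign β δ) • β' y (P (d * (x * t - ssign α τ • (t * x)) * c))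
        = ssign α δ • P (d * ((x * y + ssign α β • (y * x)) * t
          - (ssign α τ * ssign β τ) • (t * (x * y + ssign α β • (y * x)))) * c) := by
    intro α β τ δ x y t d hx hy ht hd c
    have h1 := congrArg (ρ₃ d) (F hx hy ht c)
    rw [map_add, map_zsmul, cβ hd hx, cβ hd hy, hPmul, hPmul, hPmul] at h1
    simp only [mul_assoc] at *
    rw [← h1, ssign_comm δ, ssign_comm δ]
    linear_combination (norm := module) 
      -(ssign_mul_self α δ) • (β' x (P (d * ((y * t - ssign β τ • (t * y)) * c))))
  have cast_mem : ∀ {γ δ : ZMod 2} {x : B}, x ∈ 𝓑 γ → γ = δ → x ∈ 𝓑 δ :=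
    fun hx h => h ▸ hx
  have R_mem : ∀ {α β τ : ZMod 2} {x y t : B}, x ∈ 𝓑 α → y ∈ 𝓑 β → t ∈ 𝓑 τ →
      (x * y + ssign α β • (y * x)) * t
        - (ssign α τ * ssign β τ) • (t * (x * y + ssign α β • (y * x))) ∈ 𝓑 (α + β + τ) := by
    intro α β τ x y t hx hy ht
    have hxy : x * y + ssign α β • (y * x) ∈ 𝓑 (α + β) :=
      add_mem (h𝓑.mul_mem hx hy)
        (zsmul_mem (cast_mem (h𝓑.mul_mem hy hx) (add_comm _ _)) _)
    exact sub_mem (h𝓑.mul_mem hxy ht)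
      (zsmul_mem (cast_mem (h𝓑.mul_mem ht hxy) (add_comm _ _)) _)
  have F' : ∀ {α β τ : ZMod 2} {x y t : B}, x ∈ 𝓑 α → y ∈ 𝓑 β → t ∈ 𝓑 τ →
      ∃ r ∈ 𝓑 (α + β + τ), ∀ c, β' x (P ((y * t - ssign β τ • (t * y)) * c))
        + ssign α β • β' y (P ((x * t - ssign α τ • (t * x)) * c)) = P (r * c) :=
    fun hx hy ht => ⟨_, R_mem hx hy ht, F hx hy ht⟩
  have Fl' : ∀ {α β τ : ZMod 2} {x y t : B}, x ∈ 𝓑 α → y ∈ 𝓑 β → t ∈ 𝓑 τ →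
      ∃ r ∈ 𝓑 (α + β + τ), ∀ {δ : ZMod 2} {d : B}, d ∈ 𝓑 δ → ∀ c,
      β' x (P (d * (y * t - ssign β τ • (t * y)) * c))
        + (ssign α β * ssign α δ * ssign β δ) • β' y (P (d * (x * t - ssign α τ • (t * x)) * c))
        = ssign α δ • P (d * r * c) :=
    fun hx hy ht => ⟨_, R_mem hx hy ht, fun hd => Fl hx hy ht hd⟩
  let N : ZMod 2 → Submodule K (B →ₗ[K] V) := fun γ =>
    (𝓑 γ).map ((LinearMap.mul K B).compr₂ P)
  have mem_N : ∀ {γ : ZMod 2} {f : B →ₗ[K] V},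
      f ∈ N γ ↔ ∃ r ∈ 𝓑 γ, ∀ s, f s = P (r * s) := by
    intro γ f
    constructor
    · rintro ⟨r, hr, rfl⟩
      exact ⟨r, hr, fun s => rfl⟩
    · rintro ⟨r, hr, h⟩
      exact ⟨r, hr, LinearMap.ext fun s => (h s).symm⟩
  let Φ : B → B →ₗ[K] B →ₗ[K] V := fun z => (LinearMap.mul K B).compr₂ (β' z ∘ₗ P)
  have hΦ : ∀ z u s, Φ z u s = β' z (P (u * s)) := fun _ _ _ => rfl
  have H : ∀ {ζ ω υ : ZMod 2} {z w u : B}, z ∈ 𝓑 ζ → w ∈ 𝓑 ω → u ∈ 𝓑 υ →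
      (Φ (z * w) - ssign ζ ω • Φ w ∘ₗ LinearMap.mulLeft K z
        - ssign ω υ • Φ z ∘ₗ LinearMap.mulRight K w) u ∈ N (ζ + ω + υ) := by
    intro ζ ω υ z w u hz hw hu
    refine h𝓑.induction _ _ ?_ hu
    rintro α β x y hx hy rfl
    obtain ⟨r₁, hr₁, h₁⟩ := F' hx (h𝓑.mul_mem hz hw) hy
    obtain ⟨r₂, hr₂, h₂⟩ := Fl' hx hw hy
    obtain ⟨r₃, hr₃, h₃⟩ := F' hx hz hy
    refine mem_N.2 ⟨(ssign α ζ * ssign α ω) • (r₁ - ssign α ζ • (z * r₂) - ssign ω β • (r₃ * w)),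
      zsmul_mem (sub_mem (sub_mem (cast_mem hr₁ (by abel))
        (zsmul_mem (cast_mem (h𝓑.mul_mem hz hr₂) (by abel)) _))
        (zsmul_mem (cast_mem (h𝓑.mul_mem hr₃ hw) (by abel)) _)) _, fun s => ?_⟩
    replace h₁ := h₁ s
    replace h₂ := h₂ hz s
    replace h₃ := h₃ (w * s)
    rw [ssign_comm ω ζ] at h₂
    simp only [LinearMap.sub_apply, LinearMap.smul_apply, LinearMap.comp_apply, hΦ,
      LinearMap.mulLeft_apply, LinearMap.mulRight_apply, ssign_add_left, ssign_add_right, 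
      mul_assoc, sub_mul, mul_sub, map_sub, smul_mul_assoc, mul_smul_comm, map_zsmul, smul_sub,
      ssign_comm ω α] at h₁ h₂ h₃ ⊢
    rcases ssign_eq_one_or α ζ with h | h <;> rcases ssign_eq_one_or α ω with h' | h' <;>
    simp only [h, h'] at h₁ h₂ h₃ ⊢ <;>
    [linear_combination (norm := module) h₁ - h₂ - ssign ω β • h₃;
      linear_combination (norm := module) -h₁ + h₂ + ssign ω β • h₃;
      linear_combination (norm := module) -h₁ + h₂ + ssign ω β • h₃;
      linear_combination (norm := module) h₁ - h₂ - ssign ω β • h₃]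
  have HZ : ∀ {ζ κ : ZMod 2} {z q : B}, z ∈ 𝓑 ζ → q ∈ 𝓑 κ → Φ z q ∈ N (ζ + κ) := by
    intro ζ κ z q hz hq
    refine h𝓑.induction _ _ ?_ hq
    rintro ω υ w u hw hu rfl
    obtain ⟨r, hr, h⟩ := mem_N.1 (H hz hw h𝓑.one_mem)
    obtain ⟨r', hr', h'⟩ := mem_N.1 (H hz hw hu)
    refine mem_N.2 ⟨r' - r * u, sub_mem (cast_mem hr' (by abel))
      (cast_mem (h𝓑.mul_mem hr hu) (by abel)), fun s => ?_⟩
    have h1 := h (u * s)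
    have h2 := h' s
    simp only [LinearMap.sub_apply, LinearMap.smul_apply, LinearMap.comp_apply, hΦ,
      LinearMap.mulLeft_apply, LinearMap.mulRight_apply, one_mul, mul_one, ssign_zero_right,
      one_smul, mul_assoc, sub_mul, map_sub, map_zsmul] at h1 h2 ⊢
    linear_combination (norm := module) h2 - h1
  have exZ : ∀ {ζ : ZMod 2} {z : B}, z ∈ 𝓑 ζ → ∃ Z ∈ 𝓑 ζ, ∀ s, β' z (P s) = P (Z * s) := by
    intro ζ z hz
    obtain ⟨Z, hZ, h⟩ := mem_N.1 (HZ hz h𝓑.one_mem)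
    exact ⟨Z, cast_mem hZ (add_zero _), fun s => by rw [← h s, hΦ, one_mul]⟩
  have central : ∀ {ζ δ : ZMod 2} {z d Z : B}, z ∈ 𝓑 ζ → d ∈ 𝓑 δ →
      (∀ s, β' z (P s) = P (Z * s)) → ∀ u, P (d * (Z * u)) = ssign ζ δ • P (Z * (d * u)) := by
    intro ζ δ z d Z hz hd hZ u
    have h1 := cβ hd hz (P u)
    rwa [hPmul, hZ, hZ, hPmul, ssign_comm] at h1
  have Ψzero : ∀ {γ : ZMod 2} {x : B}, x ∈ 𝓑 γ → ∀ u, β' x (P u) = 0 := by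
    intro γ x hx u
    refine (Submodule.mem_bot K).1 (h𝓑.induction ⊥ (β'.flip (P u)) ?_ hx)
    rintro ζ ω z w hz hw rfl
    obtain ⟨Z, hZ, hZ'⟩ := exZ hz
    obtain ⟨W, hW, hW'⟩ := exZ hw
    have h1 : β' z (β' w (P u)) - ssign ζ ω • β' w (β' z (P u)) = 0 := by
      rw [hW', hZ', hZ', hW', central hz hW hZ', ssign_smul_smul, sub_self]
    rw [Submodule.mem_bot, LinearMap.flip_apply, ← h1]
    simp only [hβ', LinearMap.add_apply, map_add, map_sub, map_zsmul, mul₁, mul₂,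
      LinearMap.sub_apply, LinearMap.smul_apply, Module.End.mul_apply]
    rw [c₁₂ hz hw, c₂₁ hz hw]
    module
  have G : ∀ {α β τ : ZMod 2} {x y t : B}, x ∈ 𝓑 α → y ∈ 𝓑 β → t ∈ 𝓑 τ → ∀ c,
      P (((x * y + ssign α β • (y * x)) * t
          - (ssign α τ * ssign β τ) • (t * (x * y + ssign α β • (y * x)))) * c) = 0 := by
    intro α β τ x y t hx hy ht c
    rw [← F hx hy ht, Ψzero hx, Ψzero hy, smul_zero, add_zero]
  have G2 : ∀ {α τ : ZMod 2} {x t : B}, x ∈ 𝓑 α → t ∈ 𝓑 τ → ∀ c,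
      P ((x * t - ssign α τ • (t * x)) * c) + P ((x * t - ssign α τ • (t * x)) * c) = 0 := by
    intro α τ x t hx ht c
    rw [← G hx h𝓑.one_mem ht c, ← map_add]
    congr 1
    simp only [ssign_zero_right, ssign_zero_left, mul_one, one_mul, one_smul]
    noncomm_ring
    module
  have G3 : ∀ {γ : ZMod 2} {x t : B}, x ∈ 𝓑 γ → ∀ {τ : ZMod 2}, t ∈ 𝓑 τ → ∀ c,
      P ((x * t - ssign γ τ • (t * x)) * c) = 0 := by
    intro γ x t hx τ ht c
    refine (Submodule.mem_bot K).1 (h𝓑.induction ⊥ 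
      (P ∘ₗ LinearMap.mulRight K c ∘ₗ (LinearMap.mulRight K t - ssign γ τ • LinearMap.mulLeft K t))
        ?_ hx)
    rintro α β x y hx' hy rfl
    rw [Submodule.mem_bot]
    have h1 := G hx' hy ht c
    have h2 := G2 (h𝓑.mul_mem hy hx') ht c
    simp only [LinearMap.sub_apply, LinearMap.smul_apply, LinearMap.comp_apply,
      LinearMap.mulLeft_apply, LinearMap.mulRight_apply, ssign_add_left,
      mul_assoc, sub_mul, add_mul, mul_add, map_sub, map_add, smul_mul_assoc,
      mul_smul_comm, map_zsmul, smul_add, smul_sub] at h1 h2 ⊢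
    linear_combination (norm := module) h1 - ssign α β • h2
  have Pzero : P 1 = 0 := by
    have := h𝓑.induction ⊥ P (x := 1) (γ := 0) ?_ h𝓑.one_mem
    · rwa [Submodule.mem_bot] at this
    rintro α β x y hx hy -
    have := G3 hx hy 1
    rwa [mul_one] at this
  rw [hP, one₃] at Pzero
  exact Pzero

theorem eq_zero_of_triple_relation_all {𝓑 : ZMod 2 → Submodule K B} (h𝓑 : IsPerfectGrading 𝓑)
    {ρ₁ ρ₂ ρ₃ : B →ₗ[K] Module.End K V}
    (one₁ : ρ₁ 1 = 1) (one₂ : ρ₂ 1 = 1) (one₃ : ρ₃ 1 = 1)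
    (mul₁ : ∀ a b, ρ₁ (a * b) = ρ₁ a * ρ₁ b) (mul₂ : ∀ a b, ρ₂ (a * b) = ρ₂ a * ρ₂ b)
    (mul₃ : ∀ a b, ρ₃ (a * b) = ρ₃ a * ρ₃ b)
    (c₁₂ : SuperCommute 𝓑 ρ₁ ρ₂) (c₁₃ : SuperCommute 𝓑 ρ₁ ρ₃) (c₂₃ : SuperCommute 𝓑 ρ₂ ρ₃)
    {v₁ v₂ v₃ : V} (hv : ∀ a, ρ₁ a v₁ + ρ₂ a v₂ + ρ₃ a v₃ = 0) :
    v₁ = 0 ∧ v₂ = 0 ∧ v₃ = 0 :=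
  ⟨eq_zero_of_triple_relation h𝓑 one₂ one₃ one₁ mul₂ mul₃ mul₁ c₂₃ c₁₂.symm c₁₃.symm
      (fun a => by rw [← hv a]; abel),
    eq_zero_of_triple_relation h𝓑 one₁ one₃ one₂ mul₁ mul₃ mul₂ c₁₃ c₁₂ c₂₃.symm
      (fun a => by rw [← hv a]; abel),
    eq_zero_of_triple_relation h𝓑 one₁ one₂ one₃ mul₁ mul₂ mul₃ c₁₂ c₁₃ c₂₃ hv⟩

end FreeTriple

section Division

variable {A F : Type*} [Ring A] [Algebra K A] [AddCommGroup F] [Module K F]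

theorem IsPerfectGrading.op {𝓐 : ZMod 2 → Submodule K A} (h𝓐 : IsPerfectGrading 𝓐) :
    IsPerfectGrading (B := Aᵐᵒᵖ)
      fun γ => (𝓐 γ).comap (MulOpposite.opLinearEquiv K).symm.toLinearMap where
  one_mem := h𝓐.one_mem
  mul_mem := fun {α β a b} ha hb => by
    rw [add_comm]
    exact h𝓐.mul_mem (a := b.unop) (b := a.unop) hb ha
  span := fun γ x hx => by
    refine h𝓐.induction _ (MulOpposite.opLinearEquiv K).toLinearMap ?_ hx
    intro α β a b ha hb hab
    have h : (MulOpposite.opLinearEquiv K).toLinearMap (a * b - ssign α β • (b * a))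
        = -ssign α β • (MulOpposite.op a * MulOpposite.op b
          - ssign α β • (MulOpposite.op b * MulOpposite.op a)) := by
      simp only [map_sub, map_zsmul, LinearEquiv.coe_coe, MulOpposite.coe_opLinearEquiv,
        MulOpposite.op_mul]
      linear_combination (norm := module)
        -(ssign_mul_self α β) • (MulOpposite.op b * MulOpposite.op a)
    rw [h]
    refine zsmul_mem (Submodule.subset_span ?_) _
    exact ⟨α, β, MulOpposite.op a, MulOpposite.op b, ha, hb, hab, rfl⟩
  sup := fun x => by
    obtain ⟨a, ha, b, hb, h⟩ := h𝓐.sup x.unop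
    exact ⟨.op a, ha, .op b, hb, by rw [← MulOpposite.op_unop x, h]; rfl⟩

/-- The representation induced on the quotient by an invariant submodule. -/
def quotRep {B W : Type*} [Ring B] [Algebra K B] [AddCommGroup W] [Module K W]
    (ρ : B →ₗ[K] Module.End K W) (S : Submodule K W) (h : ∀ a, ∀ w ∈ S, ρ a w ∈ S) :
    B →ₗ[K] Module.End K (W ⧸ S) :=
  Submodule.mapQLinear S S ∘ₗ LinearMap.codRestrict (Submodule.compatibleMaps S S) ρ h

theorem quotRep_mk {B W : Type*} [Ring B] [Algebra K B] [AddCommGroup W] [Module K W]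
    (ρ : B →ₗ[K] Module.End K W) (S : Submodule K W) (h : ∀ a, ∀ w ∈ S, ρ a w ∈ S) (a : B)
    (w : W) : quotRep ρ S h a (S.mkQ w) = S.mkQ (ρ a w) := rfl

/-- If `φ` has the same total image under three supercommuting left representations as under
three right representations commuting with them, then `r₁ b φ` is expressible through the right
representations. -/
theorem exists_division {𝓐 : ZMod 2 → Submodule K A} (h𝓐 : IsPerfectGrading 𝓐)
    {r₁ r₂ r₃ l₁ l₂ l₃ : A →ₗ[K] Module.End K F}
    (one₁ : r₁ 1 = 1) (one₂ : r₂ 1 = 1) (one₃ : r₃ 1 = 1)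
    (mul₁ : ∀ a b, r₁ (a * b) = r₁ a * r₁ b) (mul₂ : ∀ a b, r₂ (a * b) = r₂ a * r₂ b)
    (mul₃ : ∀ a b, r₃ (a * b) = r₃ a * r₃ b)
    (c₁₂ : SuperCommute 𝓐 r₁ r₂) (c₁₃ : SuperCommute 𝓐 r₁ r₃) (c₂₃ : SuperCommute 𝓐 r₂ r₃)
    (one₁' : l₁ 1 = 1) (one₂' : l₂ 1 = 1) (one₃' : l₃ 1 = 1)
    (mul₁' : ∀ a b, l₁ (a * b) = l₁ b * l₁ a) (mul₂' : ∀ a b, l₂ (a * b) = l₂ b * l₂ a)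
    (mul₃' : ∀ a b, l₃ (a * b) = l₃ b * l₃ a)
    (c₁₂' : SuperCommute 𝓐 l₁ l₂) (c₁₃' : SuperCommute 𝓐 l₁ l₃) (c₂₃' : SuperCommute 𝓐 l₂ l₃)
    (comm : ∀ r ∈ ({r₁, r₂, r₃} : Set (A →ₗ[K] Module.End K F)),
      ∀ l ∈ ({l₁, l₂, l₃} : Set (A →ₗ[K] Module.End K F)), ∀ a b, r a * l b = l b * r a)
    {φ : F} (hφ : ∀ a, r₁ a φ + r₂ a φ + r₃ a φ = l₁ a φ + l₂ a φ + l₃ a φ) :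
    ∃ χ₁ χ₂ χ₃ : F, (∀ b, r₁ b φ = l₁ b χ₁ + l₂ b χ₂ + l₃ b χ₃) ∧
      (∀ b, r₁ b χ₁ = l₁ b χ₁) ∧ (∀ b, r₁ b χ₂ = l₂ b χ₂) ∧ (∀ b, r₁ b χ₃ = l₃ b χ₃) := by
  replace comm : ∀ r ∈ ({r₁, r₂, r₃} : Set (A →ₗ[K] Module.End K F)),
      ∀ l ∈ ({l₁, l₂, l₃} : Set (A →ₗ[K] Module.End K F)), ∀ a b v, r a (l b v) = l b (r a v) :=
    fun r hr l hl a b v => LinearMap.congr_fun (comm r hr l hl a b) v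
  obtain ⟨χ₁, χ₂, χ₃, hχ⟩ : ∃ χ₁ χ₂ χ₃ : F, ∀ b, r₁ b φ = l₁ b χ₁ + l₂ b χ₂ + l₃ b χ₃ := by
    let S : Submodule K (A →ₗ[K] F) :=
      LinearMap.range l₁.flip ⊔ LinearMap.range l₂.flip ⊔ LinearMap.range l₃.flip
    have mem_S : ∀ {f}, f ∈ S ↔ ∃ χ₁ χ₂ χ₃ : F, ∀ b, f b = l₁ b χ₁ + l₂ b χ₂ + l₃ b χ₃ := by
      intro f
      simp only [S, Submodule.mem_sup, LinearMap.mem_range]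
      constructor
      · rintro ⟨_, ⟨_, ⟨χ₁, rfl⟩, _, ⟨χ₂, rfl⟩, rfl⟩, _, ⟨χ₃, rfl⟩, rfl⟩
        exact ⟨χ₁, χ₂, χ₃, fun b => rfl⟩
      · rintro ⟨χ₁, χ₂, χ₃, h⟩
        exact ⟨_, ⟨_, ⟨χ₁, rfl⟩, _, ⟨χ₂, rfl⟩, rfl⟩, _, ⟨χ₃, rfl⟩,
          LinearMap.ext fun b => (h b).symm⟩
    let post : Module.End K F →ₗ[K] Module.End K (A →ₗ[K] F) := LinearMap.llcomp K A F F
    have hpost : ∀ f g b, post f g b = f (g b) := fun _ _ _ => rfl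
    have inv : ∀ r ∈ ({r₁, r₂, r₃} : Set (A →ₗ[K] Module.End K F)),
        ∀ a, ∀ f ∈ S, (post ∘ₗ r) a f ∈ S := by
      intro r hr a f hf
      obtain ⟨χ₁, χ₂, χ₃, h⟩ := mem_S.1 hf
      refine mem_S.2 ⟨r a χ₁, r a χ₂, r a χ₃, fun b => ?_⟩
      rw [LinearMap.comp_apply, hpost, h, map_add, map_add, comm r hr _ (by simp),
        comm r hr _ (by simp), comm r hr _ (by simp)]
    have sc : ∀ {r r' : A →ₗ[K] Module.End K F} (h : ∀ a, ∀ f ∈ S, (post ∘ₗ r) a f ∈ S)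
        (h' : ∀ a, ∀ f ∈ S, (post ∘ₗ r') a f ∈ S), SuperCommute 𝓐 r r' →
        SuperCommute 𝓐 (quotRep (post ∘ₗ r) S h) (quotRep (post ∘ₗ r') S h') := by
      intro r r' h h' hc α β a b ha hb v
      obtain ⟨v, rfl⟩ := S.mkQ_surjective v
      rw [quotRep_mk, quotRep_mk, quotRep_mk, quotRep_mk, ← map_zsmul]
      congr 1
      ext t
      exact hc ha hb (v t)
    have ho : ∀ {r : A →ₗ[K] Module.End K F} (h : ∀ a, ∀ f ∈ S, (post ∘ₗ r) a f ∈ S), r 1 = 1 →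
        quotRep (post ∘ₗ r) S h 1 = 1 := by
      intro r h h1
      refine LinearMap.ext fun v => ?_
      obtain ⟨v, rfl⟩ := S.mkQ_surjective v
      rw [quotRep_mk, LinearMap.comp_apply, h1]
      rfl
    have hm : ∀ {r : A →ₗ[K] Module.End K F} (h : ∀ a, ∀ f ∈ S, (post ∘ₗ r) a f ∈ S),
        (∀ a b, r (a * b) = r a * r b) → ∀ a b, quotRep (post ∘ₗ r) S h (a * b)
          = quotRep (post ∘ₗ r) S h a * quotRep (post ∘ₗ r) S h b := by
      intro r h h1 a b
      refine LinearMap.ext fun v => ?_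
      obtain ⟨v, rfl⟩ := S.mkQ_surjective v
      rw [Module.End.mul_apply, quotRep_mk, quotRep_mk, quotRep_mk, LinearMap.comp_apply, h1]
      rfl
    have h₁ := inv r₁ (by simp)
    have h₂ := inv r₂ (by simp)
    have h₃ := inv r₃ (by simp)
    have := (eq_zero_of_triple_relation_all h𝓐 (ho h₁ one₁) (ho h₂ one₂) (ho h₃ one₃)
      (hm h₁ mul₁) (hm h₂ mul₂) (hm h₃ mul₃) (sc h₁ h₂ c₁₂) (sc h₁ h₃ c₁₃) (sc h₂ h₃ c₂₃)
      (v₁ := S.mkQ (r₁.flip φ)) (v₂ := S.mkQ (r₂.flip φ)) (v₃ := S.mkQ (r₃.flip φ))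
      (fun a => ?_)).1
    · rwa [Submodule.mkQ_apply, Submodule.Quotient.mk_eq_zero, mem_S] at this
    rw [quotRep_mk, quotRep_mk, quotRep_mk, ← map_add, ← map_add, Submodule.mkQ_apply,
      Submodule.Quotient.mk_eq_zero, mem_S]
    refine ⟨l₁ a φ, l₂ a φ, l₃ a φ, fun b => ?_⟩
    have := hφ (a * b)
    rw [mul₁, mul₂, mul₃, mul₁', mul₂', mul₃'] at this
    exact this
  have key : ∀ {v₁ v₂ v₃ : F}, (∀ a : Aᵐᵒᵖ, l₁ a.unop v₁ + l₂ a.unop v₂ + l₃ a.unop v₃ = 0) →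
      v₁ = 0 ∧ v₂ = 0 ∧ v₃ = 0 := fun hv =>
    eq_zero_of_triple_relation_all h𝓐.op
      (ρ₁ := l₁ ∘ₗ (MulOpposite.opLinearEquiv K).symm.toLinearMap)
      (ρ₂ := l₂ ∘ₗ (MulOpposite.opLinearEquiv K).symm.toLinearMap)
      (ρ₃ := l₃ ∘ₗ (MulOpposite.opLinearEquiv K).symm.toLinearMap)
      one₁' one₂' one₃' (fun a b => mul₁' _ _) (fun a b => mul₂' _ _) (fun a b => mul₃' _ _)
      (fun α β a b ha hb v => c₁₂' ha hb v) (fun α β a b ha hb v => c₁₃' ha hb v)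
      (fun α β a b ha hb v => c₂₃' ha hb v) hv
  have key' : ∀ b, r₁ b χ₁ - l₁ b χ₁ = 0 ∧ r₁ b χ₂ - l₂ b χ₂ = 0 ∧ r₁ b χ₃ - l₃ b χ₃ = 0 := by
    intro b
    refine key fun c => ?_
    have h1 := hχ (b * c.unop)
    have h2 := congrArg (r₁ b) (hχ c.unop)
    rw [map_add, map_add, comm r₁ (by simp) l₁ (by simp), comm r₁ (by simp) l₂ (by simp),
      comm r₁ (by simp) l₃ (by simp), ← Module.End.mul_apply, ← mul₁, h1, mul₁', mul₂', mul₃'] at h2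
    change l₁ c.unop _ + l₂ c.unop _ + l₃ c.unop _ = 0
    rw [map_sub, map_sub, map_sub]
    simp only [Module.End.mul_apply] at h2
    linear_combination (norm := module) -h2
  exact ⟨χ₁, χ₂, χ₃, hχ, fun b => sub_eq_zero.1 (key' b).1, fun b => sub_eq_zero.1 (key' b).2.1,
    fun b => sub_eq_zero.1 (key' b).2.2⟩

end Division

section Trilinear

variable {A M : Type*} [Ring A] [Algebra K A] [AddCommGroup M] [Module K M]

/-- The family `π` consists of the projections onto the homogeneous components of `𝓐`. -/
structure IsGradingProj (𝓐 : ZMod 2 → Submodule K A) (π : ZMod 2 → A →ₗ[K] A) : Prop where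
  mem : ∀ p a, π p a ∈ 𝓐 p
  apply_of_mem : ∀ {p a}, a ∈ 𝓐 p → π p a = a
  apply_of_ne : ∀ {p q a}, a ∈ 𝓐 q → q ≠ p → π p a = 0
  add : ∀ a, π 0 a + π 1 a = a

theorem IsGradingProj.ext {𝓐 : ZMod 2 → Submodule K A} {π : ZMod 2 → A →ₗ[K] A}
    (hπ : IsGradingProj 𝓐 π) {W : Type*} [AddCommGroup W] [Module K W] {f g : A →ₗ[K] W}
    (h : ∀ p, ∀ a ∈ 𝓐 p, f a = g a) : f = g := by
  ext a
  rw [← hπ.add a, map_add, map_add, h _ _ (hπ.mem 0 a), h _ _ (hπ.mem 1 a)]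

theorem IsGradingProj.apply_mul_right {𝓐 : ZMod 2 → Submodule K A} {π : ZMod 2 → A →ₗ[K] A}
    (hπ : IsGradingProj 𝓐 π) (h𝓐 : IsPerfectGrading 𝓐) {p : ZMod 2} {a : A} (ha : a ∈ 𝓐 p)
    (q : ZMod 2) (x : A) : π (q + p) (x * a) = π q x * a := by
  refine LinearMap.congr_fun (f := π (q + p) ∘ₗ LinearMap.mulRight K a)
    (g := LinearMap.mulRight K a ∘ₗ π q) (hπ.ext fun r x hx => ?_) x
  simp only [LinearMap.comp_apply, LinearMap.mulRight_apply]
  by_cases h : r = q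
  · subst h
    rw [hπ.apply_of_mem hx, hπ.apply_of_mem (h𝓐.mul_mem hx ha)]
  · rw [hπ.apply_of_ne hx h, hπ.apply_of_ne (h𝓐.mul_mem hx ha) (by simpa using h), zero_mul]

theorem IsGradingProj.apply_mul_left {𝓐 : ZMod 2 → Submodule K A} {π : ZMod 2 → A →ₗ[K] A}
    (hπ : IsGradingProj 𝓐 π) (h𝓐 : IsPerfectGrading 𝓐) {p : ZMod 2} {a : A} (ha : a ∈ 𝓐 p)
    (q : ZMod 2) (x : A) : π (q + p) (a * x) = a * π q x := by
  refine LinearMap.congr_fun (f := π (q + p) ∘ₗ LinearMap.mulLeft K a)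
    (g := LinearMap.mulLeft K a ∘ₗ π q) (hπ.ext fun r x hx => ?_) x
  simp only [LinearMap.comp_apply, LinearMap.mulLeft_apply]
  have hm := h𝓐.mul_mem ha hx
  rw [add_comm] at hm
  by_cases h : r = q
  · subst h
    rw [hπ.apply_of_mem hx, hπ.apply_of_mem hm]
  · rw [hπ.apply_of_ne hx h, hπ.apply_of_ne hm (by simpa using h), mul_zero]

/-- The operator on families indexed by `I` that applies `Q` on the values, shifts the index by
`e` and multiplies by the sign `s`, according to the degree of the argument. -/
def shiftOp {T I : Type*} [AddCommGroup T] [Module K T] (π : ZMod 2 → A →ₗ[K] A)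
    (Q : A →ₗ[K] Module.End K T) (e : ZMod 2 → I → I) (s : ZMod 2 → I → ℤ) :
    A →ₗ[K] Module.End K (I → T) :=
  LinearMap.mk₂ K (fun a G i => s 0 i • Q (π 0 a) (G (e 0 i)) + s 1 i • Q (π 1 a) (G (e 1 i)))
    (fun a b G => by
      funext i
      simp only [map_add, LinearMap.add_apply, smul_add, Pi.add_apply]
      abel)
    (fun c a G => by
      funext i
      simp only [map_smul, LinearMap.smul_apply, smul_add, Pi.smul_apply]
      module)
    (fun a G H => by
      funext i
      simp only [map_add, smul_add, Pi.add_apply]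
      abel)
    (fun c a G => by
      funext i
      simp only [map_smul, smul_add, Pi.smul_apply]
      module)

section ShiftOp

variable {T I : Type*} [AddCommGroup T] [Module K T] {𝓐 : ZMod 2 → Submodule K A}
  {π : ZMod 2 → A →ₗ[K] A} {Q Q' : A →ₗ[K] Module.End K T} {e e' : ZMod 2 → I → I}
  {s s' : ZMod 2 → I → ℤ}

theorem shiftOp_apply (hπ : IsGradingProj 𝓐 π) {p : ZMod 2} {a : A} (ha : a ∈ 𝓐 p) (G : I → T)
    (i : I) : shiftOp π Q e s a G i = s p i • Q a (G (e p i)) := by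
  change s 0 i • Q (π 0 a) (G (e 0 i)) + s 1 i • Q (π 1 a) (G (e 1 i)) = _
  have h01 : (0 : ZMod 2) ≠ 1 := by decide
  obtain rfl | rfl := (by decide : ∀ p : ZMod 2, p = 0 ∨ p = 1) p
  · rw [hπ.apply_of_mem ha, hπ.apply_of_ne ha h01]
    simp
  · rw [hπ.apply_of_mem ha, hπ.apply_of_ne ha h01.symm]
    simp

theorem shiftOp_one (h𝓐 : IsPerfectGrading 𝓐) (hπ : IsGradingProj 𝓐 π) (hQ : Q 1 = 1)
    (he : ∀ i, e 0 i = i) (hs : ∀ i, s 0 i = 1) : shiftOp π Q e s 1 = 1 := by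
  refine LinearMap.ext fun G => funext fun i => ?_
  rw [shiftOp_apply hπ h𝓐.one_mem, hQ, he, hs, one_smul]
  rfl

theorem shiftOp_mul (h𝓐 : IsPerfectGrading 𝓐) (hπ : IsGradingProj 𝓐 π)
    (hQ : ∀ a b, Q (a * b) = Q a * Q b) (he : ∀ p q i, e (p + q) i = e q (e p i))
    (hs : ∀ p q i, s (p + q) i = s p i * s q (e p i)) (a b : A) :
    shiftOp π Q e s (a * b) = shiftOp π Q e s a * shiftOp π Q e s b := by
  refine LinearMap.congr_fun₂ (f := (LinearMap.mul K A).compr₂ (shiftOp π Q e s))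
    (g := (LinearMap.mul K _).compl₁₂ (shiftOp π Q e s) (shiftOp π Q e s))
    (hπ.ext fun p a ha => hπ.ext fun q b hb => ?_) a b
  refine LinearMap.ext fun G => funext fun i => ?_
  simp only [LinearMap.compr₂_apply, LinearMap.compl₁₂_apply, LinearMap.mul_apply',
    Module.End.mul_apply]
  rw [shiftOp_apply hπ (h𝓐.mul_mem ha hb), shiftOp_apply hπ ha, shiftOp_apply hπ hb, hQ, he, hs,
    map_zsmul, mul_smul]
  rfl

theorem shiftOp_antimul (h𝓐 : IsPerfectGrading 𝓐) (hπ : IsGradingProj 𝓐 π)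
    (hQ : ∀ a b, Q (a * b) = Q b * Q a) (he : ∀ p q i, e (p + q) i = e q (e p i))
    (hs : ∀ p q i, s (p + q) i = s p i * s q (e p i)) (a b : A) :
    shiftOp π Q e s (a * b) = shiftOp π Q e s b * shiftOp π Q e s a := by
  refine LinearMap.congr_fun₂ (f := (LinearMap.mul K A).compr₂ (shiftOp π Q e s))
    (g := (LinearMap.mul K _).flip.compl₁₂ (shiftOp π Q e s) (shiftOp π Q e s))
    (hπ.ext fun p a ha => hπ.ext fun q b hb => ?_) a b
  refine LinearMap.ext fun G => funext fun i => ?_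
  simp only [LinearMap.compr₂_apply, LinearMap.compl₁₂_apply, LinearMap.mul_apply',
    Module.End.mul_apply, LinearMap.flip_apply]
  rw [shiftOp_apply hπ (h𝓐.mul_mem ha hb), shiftOp_apply hπ hb, shiftOp_apply hπ ha, hQ,
    add_comm p q, he, hs, map_zsmul, mul_smul]
  rfl

theorem shiftOp_superCommute (hπ : IsGradingProj 𝓐 π)
    (hQ : ∀ a b, Q a * Q' b = Q' b * Q a) (he : ∀ p q i, e p (e' q i) = e' q (e p i))
    (hs : ∀ p q i, s p i * s' q (e p i) = ssign p q * (s' q i * s p (e' q i))) :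
    SuperCommute 𝓐 (shiftOp π Q e s) (shiftOp π Q' e' s') := by
  intro p q a b ha hb G
  funext i
  rw [Pi.smul_apply, shiftOp_apply hπ ha, shiftOp_apply hπ hb, shiftOp_apply hπ hb,
    shiftOp_apply hπ ha, map_zsmul, map_zsmul, smul_smul, smul_smul, smul_smul, hs, he, mul_assoc]
  congr 1
  exact LinearMap.congr_fun (hQ a b) _

theorem shiftOp_commute (hπ : IsGradingProj 𝓐 π)
    (hQ : ∀ a b, Q a * Q' b = Q' b * Q a) (he : ∀ p q i, e p (e' q i) = e' q (e p i))
    (hs : ∀ p q i, s p i * s' q (e p i) = s' q i * s p (e' q i)) (a b : A) :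
    shiftOp π Q e s a * shiftOp π Q' e' s' b = shiftOp π Q' e' s' b * shiftOp π Q e s a := by
  refine LinearMap.congr_fun₂
    (f := (LinearMap.mul K _).compl₁₂ (shiftOp π Q e s) (shiftOp π Q' e' s'))
    (g := (LinearMap.mul K _).flip.compl₁₂ (shiftOp π Q e s) (shiftOp π Q' e' s'))
    (hπ.ext fun p a ha => hπ.ext fun q b hb => ?_) a b
  refine LinearMap.ext fun G => funext fun i => ?_
  simp only [LinearMap.compl₁₂_apply, LinearMap.mul_apply', Module.End.mul_apply,
    LinearMap.flip_apply]
  rw [shiftOp_apply hπ ha, shiftOp_apply hπ hb, shiftOp_apply hπ hb,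
    shiftOp_apply hπ ha, map_zsmul, map_zsmul, smul_smul, smul_smul, hs, he]
  congr 1
  exact LinearMap.congr_fun (hQ a b) _

end ShiftOp

variable (K A M) in
/-- Precomposition in the first argument of a trilinear map. -/
def pre₁ : Module.End K A →ₗ[K] Module.End K (A →ₗ[K] A →ₗ[K] A →ₗ[K] M) :=
  (LinearMap.llcomp K A A _).flip

variable (K A M) in
/-- Precomposition in the second argument of a trilinear map. -/
def pre₂ : Module.End K A →ₗ[K] Module.End K (A →ₗ[K] A →ₗ[K] A →ₗ[K] M) :=
  LinearMap.llcomp K A _ _ ∘ₗ (LinearMap.llcomp K A A _).flip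

variable (K A M) in
/-- Precomposition in the third argument of a trilinear map. -/
def pre₃ : Module.End K A →ₗ[K] Module.End K (A →ₗ[K] A →ₗ[K] A →ₗ[K] M) :=
  LinearMap.llcomp K A _ _ ∘ₗ LinearMap.llcomp K A _ _ ∘ₗ (LinearMap.llcomp K A A _).flip

set_option linter.unusedSimpArgs false in
set_option maxHeartbeats 1600000 in
/-- A trilinear map on a perfect superalgebra that is invariant under the adjoint action and
vanishes as soon as one argument is `1` is zero. -/
theorem eq_zero_of_invariant {𝓐 : ZMod 2 → Submodule K A} (h𝓐 : IsPerfectGrading 𝓐)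
    {π : ZMod 2 → A →ₗ[K] A} (hπ : IsGradingProj 𝓐 π) (G : A →ₗ[K] A →ₗ[K] A →ₗ[K] M)
    (inv : ∀ α β γ δ, ∀ a ∈ 𝓐 α, ∀ b ∈ 𝓐 β, ∀ c ∈ 𝓐 γ, ∀ d ∈ 𝓐 δ,
      G a b (c * d - ssign γ δ • (d * c)) + ssign δ γ • G a (b * d - ssign β δ • (d * b)) c
        + ssign δ (β + γ) • G (a * d - ssign α δ • (d * a)) b c = 0)
    (one₁ : ∀ β γ, ∀ b ∈ 𝓐 β, ∀ c ∈ 𝓐 γ, G 1 b c = 0)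
    (one₂ : ∀ α γ, ∀ a ∈ 𝓐 α, ∀ c ∈ 𝓐 γ, G a 1 c = 0)
    (one₃ : ∀ α β, ∀ a ∈ 𝓐 α, ∀ b ∈ 𝓐 β, G a b 1 = 0) : G = 0 := by
  suffices h : ∀ P α β γ, α + β + γ = P → ∀ a ∈ 𝓐 α, ∀ b ∈ 𝓐 β, ∀ c ∈ 𝓐 γ, G a b c = 0 from
    hπ.ext fun _ a ha => hπ.ext fun _ b hb => hπ.ext fun _ c hc => h _ _ _ _ rfl a ha b hb c hc
  intro P
  let T := A →ₗ[K] A →ₗ[K] A →ₗ[K] M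
  let I := ZMod 2 × ZMod 2 × ZMod 2
  let e₁ : ZMod 2 → I → I := fun p i => (i.1 + p, i.2.1, i.2.2)
  let e₂ : ZMod 2 → I → I := fun p i => (i.1, i.2.1 + p, i.2.2)
  let e₃ : ZMod 2 → I → I := fun p i => (i.1, i.2.1, i.2.2 + p)
  let R : A →ₗ[K] Module.End K A := (LinearMap.mul K A).flip
  let L : A →ₗ[K] Module.End K A := LinearMap.mul K A
  let R₁ : A →ₗ[K] Module.End K T := pre₁ K A M ∘ₗ R
  let R₂ : A →ₗ[K] Module.End K T := pre₂ K A M ∘ₗ R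
  let R₃ : A →ₗ[K] Module.End K T := pre₃ K A M ∘ₗ R
  let L₁ : A →ₗ[K] Module.End K T := pre₁ K A M ∘ₗ L
  let L₂ : A →ₗ[K] Module.End K T := pre₂ K A M ∘ₗ L
  let L₃ : A →ₗ[K] Module.End K T := pre₃ K A M ∘ₗ L
  let r₁ := shiftOp (T := T) (I := I) π R₁ e₁ fun p i => ssign p (i.2.1 + i.2.2)
  let r₂ := shiftOp (T := T) (I := I) π R₂ e₂ fun p i => ssign p i.2.2
  let r₃ := shiftOp (T := T) (I := I) π R₃ e₃ fun _ _ => 1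
  let l₁ := shiftOp (T := T) (I := I) π L₁ e₁ fun p _ => ssign p (P + 1)
  let l₂ := shiftOp (T := T) (I := I) π L₂ e₂ fun p i => ssign p (P + 1 + i.1)
  let l₃ := shiftOp (T := T) (I := I) π L₃ e₃ fun p i => ssign p (P + 1 + i.1 + i.2.1)
  let φ : I → T := fun i => if i.1 + i.2.1 + i.2.2 = P then
    pre₁ K A M (π i.1) (pre₂ K A M (π i.2.1) (pre₃ K A M (π i.2.2) G)) else 0
  have hφ_apply : ∀ α β γ x y z, α + β + γ = P →
      φ (α, β, γ) x y z = G (π α x) (π β y) (π γ z) := by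
    intro α β γ x y z h
    simp only [φ, if_pos h]
    rfl
  have hφ_zero : ∀ α β γ x y z, α + β + γ ≠ P → φ (α, β, γ) x y z = 0 := by
    intro α β γ x y z h
    simp only [φ, if_neg h]
    rfl
  have hφ : ∀ a, r₁ a φ + r₂ a φ + r₃ a φ = l₁ a φ + l₂ a φ + l₃ a φ := by
    intro a
    refine LinearMap.congr_fun (f := r₁.flip φ + r₂.flip φ + r₃.flip φ)
      (g := l₁.flip φ + l₂.flip φ + l₃.flip φ)
      (hπ.ext (W := I → T) fun p a ha => ?_) a
    refine funext fun ⟨α, β, γ⟩ => LinearMap.ext fun x => LinearMap.ext fun y =>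
      LinearMap.ext fun z => ?_
    simp only [LinearMap.add_apply, LinearMap.flip_apply, Pi.add_apply, r₁, r₂, r₃, l₁, l₂, l₃,
      shiftOp_apply hπ ha, LinearMap.smul_apply, e₁, e₂, e₃]
    change ssign p (β + γ) • φ (α + p, β, γ) (x * a) y z + ssign p γ • φ (α, β + p, γ) x (y * a) z
      + (1 : ℤ) • φ (α, β, γ + p) x y (z * a) = ssign p (P + 1) • φ (α + p, β, γ) (a * x) y z
      + ssign p (P + 1 + α) • φ (α, β + p, γ) x (a * y) z
      + ssign p (P + 1 + α + β) • φ (α, β, γ + p) x y (a * z)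
    by_cases h : α + β + γ + p = P
    · rw [hφ_apply _ _ _ _ _ _ (by rw [← h]; ring), hφ_apply _ _ _ _ _ _ (by rw [← h]; ring),
        hφ_apply _ _ _ _ _ _ (by rw [← h]; ring), hφ_apply _ _ _ _ _ _ (by rw [← h]; ring),
        hφ_apply _ _ _ _ _ _ (by rw [← h]; ring), hφ_apply _ _ _ _ _ _ (by rw [← h]; ring)]
      simp only [hπ.apply_mul_right h𝓐 ha, hπ.apply_mul_left h𝓐 ha]
      have := inv α β γ p _ (hπ.mem α x) _ (hπ.mem β y) _ (hπ.mem γ z) a ha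
      simp only [map_sub, map_zsmul, LinearMap.sub_apply, LinearMap.smul_apply] at this
      have s1 : ssign p (P + 1) = ssign p (β + γ) * ssign α p := by
        rw [← h]; clear * -; revert α β γ p; decide
      have s2 : ssign p (P + 1 + α) = ssign p γ * ssign β p := by
        rw [← h]; clear * -; revert α β γ p; decide
      have s3 : ssign p (P + 1 + α + β) = ssign γ p := by
        rw [← h]; clear * -; revert α β γ p; decide
      rw [s1, s2, s3]
      linear_combination (norm := module) this
    · have hne₁ : α + p + β + γ ≠ P := by convert h using 1; ring
      have hne₂ : α + (β + p) + γ ≠ P := by convert h using 1; ring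
      have hne₃ : α + β + (γ + p) ≠ P := by convert h using 1; ring
      simp only [hφ_zero _ _ _ _ _ _ hne₁, hφ_zero _ _ _ _ _ _ hne₂, hφ_zero _ _ _ _ _ _ hne₃,
        smul_zero]
  have hRone : R 1 = 1 := LinearMap.ext fun x => mul_one x
  have hLone : L 1 = 1 := LinearMap.ext fun x => one_mul x
  have hRmul : ∀ a b, R (a * b) = R b * R a := fun a b =>
    LinearMap.ext fun x => (mul_assoc x a b).symm
  have hLmul : ∀ a b, L (a * b) = L a * L b := fun a b =>
    LinearMap.ext fun x => mul_assoc a b x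
  have hRL : ∀ a b, R a * L b = L b * R a := fun a b =>
    LinearMap.ext fun x => mul_assoc b x a
  have assoc₁ : ∀ p q i, e₁ (p + q) i = e₁ q (e₁ p i) := fun p q i => by simp only [e₁, add_assoc]
  have assoc₂ : ∀ p q i, e₂ (p + q) i = e₂ q (e₂ p i) := fun p q i => by simp only [e₂, add_assoc]
  have assoc₃ : ∀ p q i, e₃ (p + q) i = e₃ q (e₃ p i) := fun p q i => by simp only [e₃, add_assoc]
  have swap₁ : ∀ p q i, e₁ p (e₁ q i) = e₁ q (e₁ p i) := fun p q i => by
    simp only [e₁, add_right_comm]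
  have swap₂ : ∀ p q i, e₂ p (e₂ q i) = e₂ q (e₂ p i) := fun p q i => by
    simp only [e₂, add_right_comm]
  have swap₃ : ∀ p q i, e₃ p (e₃ q i) = e₃ q (e₃ p i) := fun p q i => by
    simp only [e₃, add_right_comm]
  have one_r₁ : r₁ 1 = 1 :=
    shiftOp_one h𝓐 hπ (by simp only [R₁, LinearMap.comp_apply, hRone]; rfl)
      (fun i => by simp [e₁]) fun i => ssign_zero_left _
  have one_l₁ : l₁ 1 = 1 :=
    shiftOp_one h𝓐 hπ (by simp only [L₁, LinearMap.comp_apply, hLone]; rfl)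
      (fun i => by simp [e₁]) fun i => ssign_zero_left _
  have mul_r₁ : ∀ a b, r₁ (a * b) = r₁ a * r₁ b :=
    shiftOp_mul h𝓐 hπ (fun a b => by simp only [R₁, LinearMap.comp_apply, hRmul]; rfl)
      assoc₁ fun p q i => ssign_add_left _ _ _
  have mul_l₁ : ∀ a b, l₁ (a * b) = l₁ b * l₁ a :=
    shiftOp_antimul h𝓐 hπ (fun a b => by simp only [L₁, LinearMap.comp_apply, hLmul]; rfl)
      assoc₁ fun p q i => ssign_add_left _ _ _
  have one_r₂ : r₂ 1 = 1 :=
    shiftOp_one h𝓐 hπ (by simp only [R₂, LinearMap.comp_apply, hRone]; rfl)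
      (fun i => by simp [e₂]) fun i => ssign_zero_left _
  have one_l₂ : l₂ 1 = 1 :=
    shiftOp_one h𝓐 hπ (by simp only [L₂, LinearMap.comp_apply, hLone]; rfl)
      (fun i => by simp [e₂]) fun i => ssign_zero_left _
  have mul_r₂ : ∀ a b, r₂ (a * b) = r₂ a * r₂ b :=
    shiftOp_mul h𝓐 hπ (fun a b => by simp only [R₂, LinearMap.comp_apply, hRmul]; rfl)
      assoc₂ fun p q i => ssign_add_left _ _ _
  have mul_l₂ : ∀ a b, l₂ (a * b) = l₂ b * l₂ a :=
    shiftOp_antimul h𝓐 hπ (fun a b => by simp only [L₂, LinearMap.comp_apply, hLmul]; rfl)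
      assoc₂ fun p q i => ssign_add_left _ _ _
  have one_r₃ : r₃ 1 = 1 :=
    shiftOp_one h𝓐 hπ (by simp only [R₃, LinearMap.comp_apply, hRone]; rfl)
      (fun i => by simp [e₃]) fun i => rfl
  have one_l₃ : l₃ 1 = 1 :=
    shiftOp_one h𝓐 hπ (by simp only [L₃, LinearMap.comp_apply, hLone]; rfl)
      (fun i => by simp [e₃]) fun i => ssign_zero_left _
  have mul_r₃ : ∀ a b, r₃ (a * b) = r₃ a * r₃ b :=
    shiftOp_mul h𝓐 hπ (fun a b => by simp only [R₃, LinearMap.comp_apply, hRmul]; rfl)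
      assoc₃ fun p q i => rfl
  have mul_l₃ : ∀ a b, l₃ (a * b) = l₃ b * l₃ a :=
    shiftOp_antimul h𝓐 hπ (fun a b => by simp only [L₃, LinearMap.comp_apply, hLmul]; rfl)
      assoc₃ fun p q i => ssign_add_left _ _ _
  have sc_r₁₂ : SuperCommute (V := I → T) 𝓐 r₁ r₂ := by
    refine shiftOp_superCommute hπ (fun a b => rfl) (fun p q i => rfl) ?_
    rintro p q ⟨α, β, γ⟩
    rcases ssign_eq_one_or p q with h | h <;>
      simp only [e₁, e₂, e₃, h, ssign_comm q p, ssign_add_right] <;> ring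
  have sc_l₁₂ : SuperCommute (V := I → T) 𝓐 l₁ l₂ := by
    refine shiftOp_superCommute hπ (fun a b => rfl) (fun p q i => rfl) ?_
    rintro p q ⟨α, β, γ⟩
    rcases ssign_eq_one_or p q with h | h <;>
      simp only [e₁, e₂, e₃, h, ssign_comm q p, ssign_add_right] <;> ring
  have sc_r₁₃ : SuperCommute (V := I → T) 𝓐 r₁ r₃ := by
    refine shiftOp_superCommute hπ (fun a b => rfl) (fun p q i => rfl) ?_
    rintro p q ⟨α, β, γ⟩
    rcases ssign_eq_one_or p q with h | h <;>
      simp only [e₁, e₂, e₃, h, ssign_comm q p, ssign_add_right] <;> ring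
  have sc_l₁₃ : SuperCommute (V := I → T) 𝓐 l₁ l₃ := by
    refine shiftOp_superCommute hπ (fun a b => rfl) (fun p q i => rfl) ?_
    rintro p q ⟨α, β, γ⟩
    rcases ssign_eq_one_or p q with h | h <;>
      simp only [e₁, e₂, e₃, h, ssign_comm q p, ssign_add_right] <;> ring
  have sc_r₂₃ : SuperCommute (V := I → T) 𝓐 r₂ r₃ := by
    refine shiftOp_superCommute hπ (fun a b => rfl) (fun p q i => rfl) ?_
    rintro p q ⟨α, β, γ⟩
    rcases ssign_eq_one_or p q with h | h <;>
      simp only [e₁, e₂, e₃, h, ssign_comm q p, ssign_add_right] <;> ring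
  have sc_l₂₃ : SuperCommute (V := I → T) 𝓐 l₂ l₃ := by
    refine shiftOp_superCommute hπ (fun a b => rfl) (fun p q i => rfl) ?_
    rintro p q ⟨α, β, γ⟩
    rcases ssign_eq_one_or p q with h | h <;>
      simp only [e₁, e₂, e₃, h, ssign_comm q p, ssign_add_right] <;> ring
  have c₁₁ : ∀ a b, r₁ a * l₁ b = l₁ b * r₁ a := by
    refine shiftOp_commute hπ (fun a b => ?_) swap₁ ?_
    · change pre₁ K A M (L b * R a) = pre₁ K A M (R a * L b)
      rw [hRL]
    · rintro p q ⟨α, β, γ⟩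
      simp only [e₁, e₂, e₃, mul_comm]
  have c₁₂ : ∀ a b, r₁ a * l₂ b = l₂ b * r₁ a := by
    refine shiftOp_commute hπ (fun a b => rfl) (fun p q i => rfl) ?_
    rintro p q ⟨α, β, γ⟩
    rcases ssign_eq_one_or p q with h | h <;>
      simp only [e₁, e₂, e₃, h, ssign_comm q p, ssign_add_right] <;> ring
  have c₁₃ : ∀ a b, r₁ a * l₃ b = l₃ b * r₁ a := by
    refine shiftOp_commute hπ (fun a b => rfl) (fun p q i => rfl) ?_
    rintro p q ⟨α, β, γ⟩
    rcases ssign_eq_one_or p q with h | h <;>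
      simp only [e₁, e₂, e₃, h, ssign_comm q p, ssign_add_right] <;> ring
  have c₂₁ : ∀ a b, r₂ a * l₁ b = l₁ b * r₂ a := by
    refine shiftOp_commute hπ (fun a b => rfl) (fun p q i => rfl) ?_
    rintro p q ⟨α, β, γ⟩
    rcases ssign_eq_one_or p q with h | h <;>
      simp only [e₁, e₂, e₃, h, ssign_comm q p, ssign_add_right] <;> ring
  have c₂₂ : ∀ a b, r₂ a * l₂ b = l₂ b * r₂ a := by
    refine shiftOp_commute hπ (fun a b => ?_) swap₂ ?_
    · change pre₂ K A M (L b * R a) = pre₂ K A M (R a * L b)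
      rw [hRL]
    · rintro p q ⟨α, β, γ⟩
      simp only [e₁, e₂, e₃, mul_comm]
  have c₂₃ : ∀ a b, r₂ a * l₃ b = l₃ b * r₂ a := by
    refine shiftOp_commute hπ (fun a b => rfl) (fun p q i => rfl) ?_
    rintro p q ⟨α, β, γ⟩
    rcases ssign_eq_one_or p q with h | h <;>
      simp only [e₁, e₂, e₃, h, ssign_comm q p, ssign_add_right] <;> ring
  have c₃₁ : ∀ a b, r₃ a * l₁ b = l₁ b * r₃ a := by
    refine shiftOp_commute hπ (fun a b => rfl) (fun p q i => rfl) ?_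
    rintro p q ⟨α, β, γ⟩
    rcases ssign_eq_one_or p q with h | h <;>
      simp only [e₁, e₂, e₃, h, ssign_comm q p, ssign_add_right] <;> ring
  have c₃₂ : ∀ a b, r₃ a * l₂ b = l₂ b * r₃ a := by
    refine shiftOp_commute hπ (fun a b => rfl) (fun p q i => rfl) ?_
    rintro p q ⟨α, β, γ⟩
    rcases ssign_eq_one_or p q with h | h <;>
      simp only [e₁, e₂, e₃, h, ssign_comm q p, ssign_add_right] <;> ring
  have c₃₃ : ∀ a b, r₃ a * l₃ b = l₃ b * r₃ a := by
    refine shiftOp_commute hπ (fun a b => ?_) swap₃ ?_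
    · change pre₃ K A M (L b * R a) = pre₃ K A M (R a * L b)
      rw [hRL]
    · rintro p q ⟨α, β, γ⟩
      simp only [e₁, e₂, e₃, mul_comm]
  obtain ⟨χ₁, χ₂, χ₃, h, h₁, h₂, h₃⟩ := exists_division (F := I → T) h𝓐 one_r₁ one_r₂ one_r₃
    mul_r₁ mul_r₂ mul_r₃ sc_r₁₂ sc_r₁₃ sc_r₂₃ one_l₁ one_l₂ one_l₃ mul_l₁ mul_l₂ mul_l₃
    sc_l₁₂ sc_l₁₃ sc_l₂₃ (by
      rintro r (rfl | rfl | rfl) l (rfl | rfl | rfl)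
      exacts [c₁₁, c₁₂, c₁₃, c₂₁, c₂₂, c₂₃, c₃₁, c₃₂, c₃₃]) hφ
  have c₁ : ∀ {α β γ}, α + β + γ = P → ∀ a ∈ 𝓐 α, ∀ y z, χ₁ (α, β, γ) a y z = 0 := by
    intro α β γ hP a ha y z
    have := h𝓐.induction (LinearMap.ker (χ₁ (α, β, γ))) LinearMap.id (γ := α) ?_ ha
    · rw [LinearMap.id_apply, LinearMap.mem_ker] at this
      rw [this, LinearMap.zero_apply, LinearMap.zero_apply]
    intro α' p x b hx hb hαp
    refine LinearMap.ext fun y => LinearMap.ext fun z => ?_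
    have := DFunLike.congr_fun (DFunLike.congr_fun (DFunLike.congr_fun
      (congrFun (h₁ b) (α', β, γ)) x) y) z
    simp only [r₁, l₁, shiftOp_apply hπ hb] at this
    change ssign p (β + γ) • χ₁ (α' + p, β, γ) (x * b) y z
      = ssign p (P + 1) • χ₁ (α' + p, β, γ) (b * x) y z at this
    have hs : ssign p (P + 1) = ssign p (β + γ) * ssign α' p := by
      rw [← hP, ← hαp]; clear * -; revert α' β γ p; decide
    rw [hs, hαp] at this
    have := congrArg (fun t => ssign p (β + γ) • t) this
    simp only [mul_smul, ssign_smul_smul] at this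
    simp only [LinearMap.id_apply, map_sub, map_zsmul, LinearMap.sub_apply, LinearMap.smul_apply,
      this, sub_self, LinearMap.zero_apply]
  have c₂ : ∀ {α β γ}, α + β + γ = P → ∀ a ∈ 𝓐 α, ∀ y z,
      χ₂ (α, β, γ) a y z = χ₂ (0, α + β, γ) 1 (a * y) z := by
    intro α β γ hP a ha y z
    have := DFunLike.congr_fun (DFunLike.congr_fun (DFunLike.congr_fun
      (congrFun (h₂ a) (0, β, γ)) 1) y) z
    simp only [r₁, l₂, shiftOp_apply hπ ha] at this
    change ssign α (β + γ) • χ₂ (0 + α, β, γ) (1 * a) y z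
      = ssign α (P + 1 + 0) • χ₂ (0, β + α, γ) 1 (a * y) z at this
    have hs : ssign α (P + 1 + 0) = ssign α (β + γ) := by
      rw [← hP]; clear * -; revert α β γ; decide
    rw [hs, zero_add, one_mul, add_comm β α] at this
    have := congrArg (fun t => ssign α (β + γ) • t) this
    simpa only [ssign_smul_smul] using this
  have c₃ : ∀ {α β γ}, α + β + γ = P → ∀ a ∈ 𝓐 α, ∀ y z,
      χ₃ (α, β, γ) a y z = ssign α β • χ₃ (0, β, α + γ) 1 y (a * z) := by
    intro α β γ hP a ha y z
    have := DFunLike.congr_fun (DFunLike.congr_fun (DFunLike.congr_fun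
      (congrFun (h₃ a) (0, β, γ)) 1) y) z
    simp only [r₁, l₃, shiftOp_apply hπ ha] at this
    change ssign α (β + γ) • χ₃ (0 + α, β, γ) (1 * a) y z
      = ssign α (P + 1 + 0 + β) • χ₃ (0, β, γ + α) 1 y (a * z) at this
    have hs : ssign α (P + 1 + 0 + β) = ssign α (β + γ) * ssign α β := by
      rw [← hP]; clear * -; revert α β γ; decide
    rw [hs, zero_add, one_mul, add_comm γ α] at this
    have := congrArg (fun t => ssign α (β + γ) • t) this
    simpa only [mul_smul, ssign_smul_smul] using this
  have main : ∀ {α β γ}, α + β + γ = P → ∀ a ∈ 𝓐 α, ∀ b ∈ 𝓐 β, ∀ c ∈ 𝓐 γ,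
      G a b c = χ₂ (0, α + β, γ) 1 (a * b) c
        + ssign α β • χ₃ (0, β, α + γ) 1 b (a * c) := by
    intro α β γ hP a ha b hb c hc
    have := DFunLike.congr_fun (DFunLike.congr_fun (DFunLike.congr_fun
      (congrFun (h 1) (α, β, γ)) a) b) c
    rw [one_r₁, one_l₁, one_l₂, one_l₃] at this
    change φ (α, β, γ) a b c = χ₁ (α, β, γ) a b c + χ₂ (α, β, γ) a b c + χ₃ (α, β, γ) a b c at this
    rwa [hφ_apply _ _ _ _ _ _ hP, hπ.apply_of_mem ha, hπ.apply_of_mem hb, hπ.apply_of_mem hc,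
      c₁ hP a ha, c₂ hP a ha, c₃ hP a ha, zero_add] at this
  have n₁ : ∀ {β γ}, β + γ = P → ∀ b ∈ 𝓐 β, ∀ c ∈ 𝓐 γ,
      χ₃ (0, β, γ) 1 b c = -χ₂ (0, β, γ) 1 b c := by
    intro β γ hP b hb c hc
    have := main (α := 0) (by rwa [zero_add]) 1 h𝓐.one_mem b hb c hc
    simp only [one₁ _ _ b hb c hc, zero_add, one_mul, ssign_zero_left, one_smul] at this
    exact eq_neg_of_add_eq_zero_right this.symm
  have n₂ : ∀ {α γ}, α + γ = P → ∀ a ∈ 𝓐 α, ∀ c ∈ 𝓐 γ,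
      χ₂ (0, α, γ) 1 a c = χ₂ (0, 0, α + γ) 1 1 (a * c) := by
    intro α γ hP a ha c hc
    have := main (β := 0) (by rwa [add_zero]) a ha 1 h𝓐.one_mem c hc
    simp only [one₂ _ _ a ha c hc, add_zero, mul_one, ssign_zero_right, one_smul] at this
    rw [n₁ (by rwa [zero_add]) 1 h𝓐.one_mem _ (h𝓐.mul_mem ha hc)] at this
    exact (add_neg_eq_zero.1 this.symm)
  have n₃ : ∀ a ∈ 𝓐 P, χ₂ (0, 0, P) 1 1 a = 0 := by
    intro a ha
    refine h𝓐.induction (LinearMap.ker (χ₂ (0, 0, P) 1 1)) LinearMap.id ?_ ha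
    intro α β a b ha hb hP
    have := main (γ := 0) (by rwa [add_zero]) a ha b hb 1 h𝓐.one_mem
    have hP' : β + α = P := by rw [← hP, add_comm]
    simp only [one₃ _ _ a ha b hb, add_zero, mul_one] at this
    rw [n₁ hP' b hb a ha, n₂ hP' b hb a ha, hP', n₂ (by rwa [add_zero]) _ (h𝓐.mul_mem ha hb) _
      h𝓐.one_mem, mul_one, add_zero, hP] at this
    rw [LinearMap.id_apply, LinearMap.mem_ker, map_sub, map_zsmul]
    linear_combination (norm := module) -this
  have n₄ : ∀ {β γ}, β + γ = P → ∀ b ∈ 𝓐 β, ∀ c ∈ 𝓐 γ, χ₂ (0, β, γ) 1 b c = 0 := by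
    intro β γ hP b hb c hc
    rw [n₂ hP b hb c hc, hP, n₃ _ (by rw [← hP]; exact h𝓐.mul_mem hb hc)]
  intro α β γ hP a ha b hb c hc
  have hP' : β + (α + γ) = P := by rw [← hP]; ring
  rw [main hP a ha b hb c hc, n₄ hP _ (h𝓐.mul_mem ha hb) c hc,
    n₁ hP' b hb _ (h𝓐.mul_mem ha hc), n₄ hP' b hb _ (h𝓐.mul_mem ha hc), neg_zero, smul_zero,
    add_zero]

end Trilinear

section Cocycle

variable {A M : Type*} [Ring A] [Algebra K A] [AddCommGroup M] [Module K M]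

/-- A family of trilinear maps indexed by degrees glues to one trilinear map. -/
theorem IsGradingProj.exists_trilinear {𝓐 : ZMod 2 → Submodule K A} {π : ZMod 2 → A →ₗ[K] A}
    (hπ : IsGradingProj 𝓐 π) (H : ZMod 2 → ZMod 2 → ZMod 2 → A →ₗ[K] A →ₗ[K] A →ₗ[K] M) :
    ∃ G : A →ₗ[K] A →ₗ[K] A →ₗ[K] M, ∀ α β γ, ∀ a ∈ 𝓐 α, ∀ b ∈ 𝓐 β, ∀ c ∈ 𝓐 γ,
      G a b c = H α β γ a b c := by
  let X : ZMod 2 → ZMod 2 → ZMod 2 → A →ₗ[K] A →ₗ[K] A →ₗ[K] M := fun p q r =>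
    pre₁ K A M (π p) (pre₂ K A M (π q) (pre₃ K A M (π r) (H p q r)))
  have hX : ∀ p q r a b c, X p q r a b c = H p q r (π p a) (π q b) (π r c) :=
    fun _ _ _ _ _ _ => rfl
  refine ⟨(X 0 0 0 + X 0 0 1 + X 0 1 0 + X 0 1 1) + (X 1 0 0 + X 1 0 1 + X 1 1 0 + X 1 1 1),
    fun α β γ a ha b hb c hc => ?_⟩
  have h01 : (0 : ZMod 2) ≠ 1 := by decide
  have key : ∀ {p a}, a ∈ 𝓐 p → p = 0 ∧ π 0 a = a ∧ π 1 a = 0 ∨ p = 1 ∧ π 0 a = 0 ∧ π 1 a = a := by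
    intro p a ha
    obtain rfl | rfl := (by decide : ∀ p : ZMod 2, p = 0 ∨ p = 1) p
    · exact Or.inl ⟨rfl, hπ.apply_of_mem ha, hπ.apply_of_ne ha h01⟩
    · exact Or.inr ⟨rfl, hπ.apply_of_ne ha h01.symm, hπ.apply_of_mem ha⟩
  simp only [LinearMap.add_apply, hX]
  rcases key ha with ⟨rfl, h1, h2⟩ | ⟨rfl, h1, h2⟩ <;>
  rcases key hb with ⟨rfl, h3, h4⟩ | ⟨rfl, h3, h4⟩ <;>
  rcases key hc with ⟨rfl, h5, h6⟩ | ⟨rfl, h5, h6⟩ <;>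
  simp only [h1, h2, h3, h4, h5, h6, map_zero, LinearMap.zero_apply, add_zero, zero_add]

theorem supercomm_mem {𝓐 : ZMod 2 → Submodule K A} (h𝓐 : IsPerfectGrading 𝓐) {α β : ZMod 2}
    {a b : A} (ha : a ∈ 𝓐 α) (hb : b ∈ 𝓐 β) : a * b - ssign α β • (b * a) ∈ 𝓐 (α + β) := by
  refine sub_mem (h𝓐.mul_mem ha hb) (zsmul_mem ?_ _)
  rw [add_comm]
  exact h𝓐.mul_mem hb ha

/-- A super skew-symmetric Lie cocycle on a perfect superalgebra is a cyclic cocycle. -/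
theorem cyclic_of_cocycle {𝓐 : ZMod 2 → Submodule K A} (h𝓐 : IsPerfectGrading 𝓐)
    {π : ZMod 2 → A →ₗ[K] A} (hπ : IsGradingProj 𝓐 π) (f : A →ₗ[K] A →ₗ[K] M)
    (skew : ∀ α β, ∀ a ∈ 𝓐 α, ∀ b ∈ 𝓐 β, f a b = -(ssign α β • f b a))
    (cocycle : ∀ α β γ, ∀ a ∈ 𝓐 α, ∀ b ∈ 𝓐 β, ∀ c ∈ 𝓐 γ,
      f (a * b - ssign α β • (b * a)) c = f a (b * c - ssign β γ • (c * b))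
        - ssign α β • f b (a * c - ssign α γ • (c * a)))
    {α β γ : ZMod 2} {a b c : A} (ha : a ∈ 𝓐 α) (hb : b ∈ 𝓐 β) (hc : c ∈ 𝓐 γ) :
    f (a * b) c - f a (b * c) + ssign γ (α + β) • f (c * a) b = 0 := by
  have f_one : ∀ α, ∀ a ∈ 𝓐 α, f a 1 = 0 := by
    intro α a ha
    refine h𝓐.induction (LinearMap.ker (f.flip 1)) LinearMap.id ?_ ha
    intro α β x y hx hy _
    rw [LinearMap.id_apply, LinearMap.mem_ker, LinearMap.flip_apply,
      cocycle _ _ _ x hx y hy 1 h𝓐.one_mem]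
    simp [ssign_zero_right]
  have one_f : ∀ α, ∀ a ∈ 𝓐 α, f 1 a = 0 := by
    intro α a ha
    rw [skew _ _ 1 h𝓐.one_mem a ha, f_one _ a ha, smul_zero, neg_zero]
  let t₁ : A →ₗ[K] A →ₗ[K] A →ₗ[K] M := (LinearMap.mul K A).compr₂ f
  let t₂ : A →ₗ[K] A →ₗ[K] A →ₗ[K] M := ((LinearMap.lflip (R₀ := K)).toLinearMap ∘ₗ t₁).flip
  let t₃ : A →ₗ[K] A →ₗ[K] A →ₗ[K] M := ((LinearMap.lflip (R₀ := K)).toLinearMap ∘ₗ t₂).flip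
  obtain ⟨G, hG'⟩ := hπ.exists_trilinear fun p q r =>
    t₁ + ssign p (q + r) • t₂ + ssign r (p + q) • t₃
  have hG : ∀ α β γ, ∀ a ∈ 𝓐 α, ∀ b ∈ 𝓐 β, ∀ c ∈ 𝓐 γ, G a b c
      = f (a * b) c + ssign α (β + γ) • f (b * c) a + ssign γ (α + β) • f (c * a) b := by
    intro α β γ a ha b hb c hc
    rw [hG' α β γ a ha b hb c hc]
    rfl
  clear hG'
  have hL : ∀ ξ η δ, ∀ x ∈ 𝓐 ξ, ∀ y ∈ 𝓐 η, ∀ d ∈ 𝓐 δ, f x (y * d - ssign η δ • (d * y))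
      + ssign δ η • f (x * d - ssign ξ δ • (d * x)) y = f (x * y - ssign ξ η • (y * x)) d := by
    intro ξ η δ x hx y hy d hd
    have k : ssign ξ η * ssign η (ξ + δ) = ssign δ η := by
      clear * -; revert ξ η δ; decide
    rw [cocycle _ _ _ x hx y hy d hd, skew _ _ y hy _ (supercomm_mem h𝓐 hx hd), ← k]
    module
  have hT : ∀ υ ω δ, ∀ u ∈ 𝓐 υ, ∀ v ∈ 𝓐 ω, ∀ d ∈ 𝓐 δ, ∀ y,
      f (u * (v * d - ssign ω δ • (d * v))) y + ssign δ ω • f ((u * d - ssign υ δ • (d * u)) * v) y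
        = f (u * v * d - ssign (υ + ω) δ • (d * (u * v))) y := by
    intro υ ω δ u hu v hv d hd y
    rw [ssign_add_left, ssign_comm δ ω]
    simp only [mul_sub, sub_mul, map_sub, mul_smul_comm, smul_mul_assoc, map_zsmul, mul_assoc,
      LinearMap.sub_apply, LinearMap.smul_apply]
    module
  have hG0 : G = 0 := by
    refine eq_zero_of_invariant h𝓐 hπ G ?_ ?_ ?_ ?_
    · intro α β γ δ a ha b hb c hc d hd
      rw [hG _ _ _ a ha b hb _ (supercomm_mem h𝓐 hc hd),
        hG _ _ _ a ha _ (supercomm_mem h𝓐 hb hd) c hc,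
        hG _ _ _ _ (supercomm_mem h𝓐 ha hd) b hb c hc]
      have L₁ := hL _ _ _ _ (h𝓐.mul_mem ha hb) c hc d hd
      have L₂ := hL _ _ _ _ (h𝓐.mul_mem hb hc) a ha d hd
      have L₃ := hL _ _ _ _ (h𝓐.mul_mem hc ha) b hb d hd
      have T₁ := hT _ _ _ a ha b hb d hd c
      have T₂ := hT _ _ _ b hb c hc d hd a
      have T₃ := hT _ _ _ c hc a ha d hd b
      have sum : a * b * c - ssign (α + β) γ • (c * (a * b))
          + ssign α (β + γ) • (b * c * a - ssign (β + γ) α • (a * (b * c)))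
          + ssign γ (α + β) • (c * a * b - ssign (γ + α) β • (b * (c * a))) = 0 := by
        have k₁ : ssign (α + β) γ = ssign γ (α + β) := ssign_comm _ _
        have k₂ : ssign α (β + γ) * ssign (β + γ) α = 1 := by
          rw [ssign_comm (β + γ), ssign_mul_self]
        have k₃ : ssign γ (α + β) * ssign (γ + α) β = ssign α (β + γ) := by
          clear * -; revert α β γ; decide
        simp only [mul_assoc]
        linear_combination (norm := module)
          -k₁ • (c * (a * b)) - k₂ • (a * (b * c)) - k₃ • (b * (c * a))
      replace sum := congrArg (fun t => f t d) sum
      simp only [map_add, map_zsmul, map_zero, LinearMap.add_apply, LinearMap.smul_apply,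
        LinearMap.zero_apply] at sum
      rw [← L₁, ← L₂, ← L₃, ← T₁, ← T₂, ← T₃] at sum
      have k₁ : ssign α (β + (γ + δ)) = ssign α (β + γ) * ssign δ α := by
        clear * -; revert α β γ δ; decide
      have k₂ : ssign α (β + δ + γ) = ssign α (β + γ) * ssign δ α := by
        clear * -; revert α β γ δ; decide
      have k₃ : ssign δ (β + γ) * ssign (α + δ) (β + γ) = ssign α (β + γ) := by
        clear * -; revert α β γ δ; decide
      have k₄ : ssign (γ + δ) (α + β) = ssign γ (α + β) * ssign δ β * ssign δ α := by
        clear * -; revert α β γ δ; decide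
      have k₅ : ssign δ γ * ssign γ (α + (β + δ)) = ssign γ (α + β) := by
        clear * -; revert α β γ δ; decide
      have k₆ : ssign δ (β + γ) * ssign γ (α + δ + β) = ssign γ (α + β) * ssign δ β := by
        clear * -; revert α β γ δ; decide
      have k₇ : ssign δ (β + γ) = ssign δ γ * ssign δ β := by
        rw [ssign_add_right, mul_comm]
      rw [k₁, k₂, k₄]
      simp only [smul_add, ← mul_smul, k₃, k₅, k₆] at sum ⊢
      rw [k₇]
      linear_combination (norm := module) sum
    · intro β γ b hb c hc
      rw [hG _ _ _ 1 h𝓐.one_mem b hb c hc, one_mul, mul_one, f_one _ _ (h𝓐.mul_mem hb hc),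
        zero_add, skew _ _ b hb c hc, ssign_comm]
      simp
    · intro α γ a ha c hc
      rw [hG _ _ _ a ha 1 h𝓐.one_mem c hc, one_mul, mul_one, f_one _ _ (h𝓐.mul_mem hc ha),
        zero_add, skew _ _ a ha c hc, add_zero]
      simp
    · intro α β a ha b hb
      rw [hG _ _ _ a ha b hb 1 h𝓐.one_mem, one_mul, mul_one, f_one _ _ (h𝓐.mul_mem ha hb),
        add_zero, skew _ _ a ha b hb, ssign_zero_left]
      simp
  have := hG _ _ _ a ha b hb c hc
  rw [hG0, LinearMap.zero_apply, LinearMap.zero_apply, LinearMap.zero_apply] at this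
  rw [skew _ _ a ha _ (h𝓐.mul_mem hb hc), sub_neg_eq_add, ← this]

end Cocycle

section Graded

variable {V W M : Type*} [AddCommGroup V] [Module K V] [AddCommGroup W] [Module K W]
  [AddCommGroup M] [Module K M]

theorem internal_ext {g : ZMod 2 → Submodule K V} (h : DirectSum.IsInternal g) {f f' : V →ₗ[K] W}
    (hf : ∀ p, ∀ x ∈ g p, f x = f' x) : f = f' := by
  have : ⨆ p, g p ≤ LinearMap.eqLocus f f' := iSup_le fun p x hx => hf p x hx
  rw [h.submodule_iSup_eq_top] at this
  exact LinearMap.ext fun x => this trivial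

theorem exists_internal_proj {g : ZMod 2 → Submodule K V} (h : DirectSum.IsInternal g) :
    ∃ π : ∀ p, V →ₗ[K] g p, (∀ p (x : g p), π p x = x) ∧
      (∀ p q (x : g q), q ≠ p → π p x = 0) ∧ ∀ x, (π 0 x : V) + π 1 x = x := by
  let e := LinearEquiv.ofBijective (DirectSum.coeLinearMap g) h
  have he : ∀ q (x : g q), e.symm x = DirectSum.lof K (ZMod 2) (fun p => g p) q x := by
    intro q x
    rw [LinearEquiv.symm_apply_eq]
    exact (DirectSum.coeLinearMap_lof g q x).symm
  let π : ∀ p, V →ₗ[K] g p := fun p => DirectSum.component K (ZMod 2) (fun p => g p) p ∘ₗ e.symm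
  have h1 : ∀ p (x : g p), π p x = x := fun p x => by
    simp only [π, LinearMap.comp_apply, LinearEquiv.coe_coe, he, DirectSum.component.lof_self]
  have h2 : ∀ p q (x : g q), q ≠ p → π p x = 0 := fun p q x hqp => by
    simp only [π, LinearMap.comp_apply, LinearEquiv.coe_coe, he, DirectSum.component.of,
      dif_neg hqp]
  refine ⟨π, h1, h2, fun x => ?_⟩
  refine LinearMap.congr_fun (f := (g 0).subtype ∘ₗ π 0 + (g 1).subtype ∘ₗ π 1)
    (g := LinearMap.id) (internal_ext h fun p x hx => ?_) x
  have h01 : (0 : ZMod 2) ≠ 1 := by decide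
  simp only [LinearMap.add_apply, LinearMap.comp_apply, Submodule.subtype_apply,
    LinearMap.id_apply]
  obtain rfl | rfl := (by decide : ∀ p : ZMod 2, p = 0 ∨ p = 1) p
  · rw [h1 0 ⟨x, hx⟩, h2 1 0 ⟨x, hx⟩ h01]
    simp
  · rw [h1 1 ⟨x, hx⟩, h2 0 1 ⟨x, hx⟩ h01.symm]
    simp

theorem exists_bilinear {g : ZMod 2 → Submodule K V} {g' : ZMod 2 → Submodule K W}
    (h : DirectSum.IsInternal g) (h' : DirectSum.IsInternal g')
    (B : ∀ p q, g p →ₗ[K] g' q →ₗ[K] M) :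
    ∃ P : V →ₗ[K] W →ₗ[K] M, ∀ p q (x : g p) (y : g' q), P x y = B p q x y := by
  obtain ⟨π, h1, h2, -⟩ := exists_internal_proj h
  obtain ⟨π', h1', h2', -⟩ := exists_internal_proj h'
  refine ⟨(B 0 0).compl₁₂ (π 0) (π' 0) + (B 0 1).compl₁₂ (π 0) (π' 1)
    + (B 1 0).compl₁₂ (π 1) (π' 0) + (B 1 1).compl₁₂ (π 1) (π' 1), fun p q x y => ?_⟩
  have h01 : (0 : ZMod 2) ≠ 1 := by decide
  simp only [LinearMap.add_apply, LinearMap.compl₁₂_apply]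
  obtain rfl | rfl := (by decide : ∀ p : ZMod 2, p = 0 ∨ p = 1) p <;>
  obtain rfl | rfl := (by decide : ∀ p : ZMod 2, p = 0 ∨ p = 1) q <;>
  simp [h1, h1', fun x => h2 1 0 x h01, fun x => h2 0 1 x h01.symm, fun y => h2' 1 0 y h01,
    fun y => h2' 0 1 y h01.symm]

end Graded

namespace AssocSuperalgebra

variable (A : AssocSuperalgebra K)

theorem exists_gradingProj : ∃ π : ZMod 2 → A.carrier →ₗ[K] A.carrier,
    IsGradingProj A.grading π := by
  obtain ⟨π, h1, h2, h3⟩ := exists_internal_proj A.isInternal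
  refine ⟨fun p => (A.grading p).subtype ∘ₗ π p, fun p a => (π p a).2, fun {p a} ha => ?_,
    fun {p q a} ha hqp => ?_, h3⟩
  · simp [h1 p ⟨a, ha⟩]
  · simp [h2 p q ⟨a, ha⟩ hqp]

theorem isPerfectGrading (hperf : commSpan A.toNu = ⊤) : IsPerfectGrading A.grading where
  one_mem := A.one_mem
  mul_mem := A.grading_mul _ _ _ _
  sup x := by
    obtain ⟨π, hπ⟩ := A.exists_gradingProj
    exact ⟨_, hπ.mem 0 x, _, hπ.mem 1 x, (hπ.add x).symm⟩
  span γ x hx := by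
    obtain ⟨π, hπ⟩ := A.exists_gradingProj
    have : commSpan A.toNu ≤ (Submodule.span K (superComms A.grading γ)).comap (π γ) := by
      refine Submodule.span_le.2 ?_
      rintro _ ⟨α, β, ⟨a, ha⟩, ⟨b, hb⟩, rfl⟩
      change a ∈ A.grading α at ha
      change b ∈ A.grading β at hb
      change π γ (a * b - ssign α β • (b * a)) ∈ Submodule.span K (superComms A.grading γ)
      have hm : a * b - ssign α β • (b * a) ∈ A.grading (α + β) := by
        refine sub_mem (A.grading_mul _ _ _ _ ha hb) (zsmul_mem ?_ _)
        rw [add_comm]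
        exact A.grading_mul _ _ _ _ hb ha
      by_cases h : α + β = γ
      · subst h
        rw [hπ.apply_of_mem hm]
        exact Submodule.subset_span ⟨α, β, a, b, ha, hb, rfl, rfl⟩
      · rw [hπ.apply_of_ne hm h]
        exact zero_mem _
    rw [hperf] at this
    have : π γ x ∈ Submodule.span K (superComms A.grading γ) := this (show x ∈ ⊤ from trivial)
    rwa [hπ.apply_of_mem hx] at this

/-- The projection of `A ⊗ A` onto `V(A)`, with the carrier of `A.toNu` unfolded. -/
def mkV : A.carrier ⊗[K] A.carrier →ₗ[K] A.carrier ⊗[K] A.carrier ⧸ IA A.toNu :=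
  (IA A.toNu).mkQ

theorem mkV_surjective : Function.Surjective A.mkV :=
  (IA A.toNu).mkQ_surjective

/-- The class of `a ⊗ b` in `V(A)`. -/
def symbol (a b : A.carrier) : A.carrier ⊗[K] A.carrier ⧸ IA A.toNu :=
  A.mkV (a ⊗ₜ[K] b)

variable {A}

theorem symbol_skew {α β : ZMod 2} {a b : A.carrier} (ha : a ∈ A.grading α)
    (hb : b ∈ A.grading β) : A.symbol a b = -(ssign α β • A.symbol b a) := by
  rw [eq_neg_iff_add_eq_zero, symbol, symbol, ← map_zsmul, ← map_add]
  refine (Submodule.Quotient.mk_eq_zero _).2 (Submodule.subset_span (Or.inl ?_))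
  exact ⟨α, β, ⟨a, ha⟩, ⟨b, hb⟩, rfl⟩

theorem symbol_cyclic {α β γ : ZMod 2} {a b c : A.carrier} (ha : a ∈ A.grading α)
    (hb : b ∈ A.grading β) (hc : c ∈ A.grading γ) :
    A.symbol (a * b) c - A.symbol a (b * c) + ssign γ (α + β) • A.symbol (c * a) b = 0 := by
  rw [symbol, symbol, symbol, ← map_zsmul, ← map_sub, ← map_add]
  refine (Submodule.Quotient.mk_eq_zero _).2 (Submodule.subset_span (Or.inr ?_))
  exact ⟨α, β, γ, ⟨a, ha⟩, ⟨b, hb⟩, ⟨c, hc⟩, rfl⟩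

theorem symbol_sub_zsmul_left (a b c : A.carrier) (s : ℤ) :
    A.symbol (a - s • b) c = A.symbol a c - s • A.symbol b c := by
  let f : A.carrier →ₗ[K] A.carrier ⊗[K] A.carrier ⧸ IA A.toNu :=
    A.mkV ∘ₗ (TensorProduct.mk K A.carrier A.carrier).flip c
  change f (a - s • b) = f a - s • f b
  rw [map_sub, map_zsmul]

theorem symbol_jacobi {α β γ : ZMod 2} {a b c : A.carrier} (ha : a ∈ A.grading α)
    (hb : b ∈ A.grading β) (hc : c ∈ A.grading γ) :
    -A.symbol (a * b - ssign α β • (b * a)) c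
      + ssign β γ • A.symbol (a * c - ssign α γ • (c * a)) b
      - ssign α (β + γ) • A.symbol (b * c - ssign β γ • (c * b)) a = 0 := by
  simp only [symbol_sub_zsmul_left]
  have h1 := symbol_cyclic ha hb hc
  have h2 := symbol_cyclic hb ha hc
  rw [symbol_skew ha (A.grading_mul _ _ _ _ hb hc)] at h1
  rw [symbol_skew hb (A.grading_mul _ _ _ _ ha hc)] at h2
  have k1 : ssign β γ * ssign α γ = ssign γ (α + β) := by
    clear * -; revert α β γ; decide
  have k2 : ssign α (β + γ) * ssign β γ = ssign α β * ssign γ (β + α) := by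
    clear * -; revert α β γ; decide
  have k3 : ssign β γ = ssign α β * ssign β (α + γ) := by
    clear * -; revert α β γ; decide
  linear_combination (norm := module) -h1 + ssign α β • h2 - k1 • A.symbol (c * a) b
    + k2 • A.symbol (c * b) a + k3 • A.symbol (a * c) b

theorem exists_lift_of_cocycle {M : Type*} [AddCommGroup M] [Module K M]
    (hperf : commSpan A.toNu = ⊤) (f : A.carrier →ₗ[K] A.carrier →ₗ[K] M)
    (skew : ∀ α β, ∀ a ∈ A.grading α, ∀ b ∈ A.grading β, f a b = -(ssign α β • f b a))
    (cocycle : ∀ α β γ, ∀ a ∈ A.grading α, ∀ b ∈ A.grading β, ∀ c ∈ A.grading γ,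
      f (a * b - ssign α β • (b * a)) c = f a (b * c - ssign β γ • (c * b))
        - ssign α β • f b (a * c - ssign α γ • (c * a))) :
    ∃ θ : (A.carrier ⊗[K] A.carrier ⧸ IA A.toNu) →ₗ[K] M, ∀ a b, θ (A.symbol a b) = f a b := by
  obtain ⟨π, hπ⟩ := A.exists_gradingProj
  refine ⟨(IA A.toNu).liftQ (TensorProduct.lift f) ?_, fun a b => ?_⟩
  · refine Submodule.span_le.2 ?_
    rintro _ (⟨α, β, ⟨a, ha⟩, ⟨b, hb⟩, rfl⟩ | ⟨α, β, γ, ⟨a, ha⟩, ⟨b, hb⟩, ⟨c, hc⟩, rfl⟩)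
    · change A.carrier at a b
      change TensorProduct.lift f (a ⊗ₜ[K] b + ssign α β • (b ⊗ₜ[K] a)) = 0
      rw [map_add, map_zsmul]
      change f a b + ssign α β • f b a = 0
      rw [skew α β a ha b hb, neg_add_cancel]
    · have := cyclic_of_cocycle (A.isPerfectGrading hperf) hπ f skew cocycle ha hb hc
      change A.carrier at a b c
      change TensorProduct.lift f ((a * b : A.carrier) ⊗ₜ[K] c - a ⊗ₜ[K] (b * c : A.carrier)
        + ssign γ (α + β) • ((c * a : A.carrier) ⊗ₜ[K] b)) = 0
      rw [map_add, map_sub, map_zsmul]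
      exact this
  · exact (Submodule.liftQ_apply _ _ _).trans (TensorProduct.lift.tmul _ _)

end AssocSuperalgebra

theorem internal_tensor_ext {V W M : Type*} [AddCommGroup V] [Module K V] [AddCommGroup W]
    [Module K W] [AddCommGroup M] [Module K M] {g : ZMod 2 → Submodule K V}
    {g' : ZMod 2 → Submodule K W} (h : DirectSum.IsInternal g) (h' : DirectSum.IsInternal g')
    {f f' : V ⊗[K] W →ₗ[K] M}
    (hf : ∀ p q, ∀ x ∈ g p, ∀ y ∈ g' q, f (x ⊗ₜ[K] y) = f' (x ⊗ₜ[K] y)) : f = f' :=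
  TensorProduct.ext (internal_ext h fun p x hx => internal_ext h' fun q y hy => hf p q x hx y hy)

theorem TensorData.exists_pairing {M N T : LieSuperalgebra K} {a1 : LieSuperAction M N}
    {a2 : LieSuperAction N M} (ι : TensorData a1 a2 T) :
    ∃ P : M.carrier →ₗ[K] N.carrier →ₗ[K] T.carrier,
      ∀ α β (m : M.grading α) (n : N.grading β), P m n = ι.pair α β m n :=
  exists_bilinear M.isInternal N.isInternal fun α β => LinearMap.mk₂ K (ι.pair α β)
    (ι.pair_add_left α β) (ι.pair_smul_left α β) (ι.pair_add_right α β) (ι.pair_smul_right α β)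

theorem TensorData.exists_lift {A : AssocSuperalgebra K} (hperf : commSpan A.toNu = ⊤)
    {brA : A.carrier →ₗ[K] A.carrier →ₗ[K] A.carrier}
    (hbrA : ∀ {α β a b}, a ∈ A.grading α → b ∈ A.grading β →
      brA a b = a * b - ssign α β • (b * a))
    {L N T : LieSuperalgebra K} {e : L.carrier ≃ₗ[K] A.carrier}
    (hgr : ∀ {α x}, x ∈ L.grading α ↔ e x ∈ A.grading α)
    (hbr : ∀ x y, e (L.bracket x y) = brA (e x) (e y))
    {d : N.carrier →ₗ[K] A.carrier}
    (hsurj : ∀ β, ∀ b ∈ A.grading β, ∃ n ∈ N.grading β, d n = b)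
    (hdbr : ∀ n n', d (N.bracket n n') = brA (d n) (d n'))
    {a1 : LieSuperAction L N} {a2 : LieSuperAction N L}
    (ha1 : ∀ x n, d (a1.act x n) = brA (e x) (d n)) (ha1' : ∀ x n, d n = 0 → a1.act x n = 0)
    (ha2 : ∀ n x, e (a2.act n x) = brA (d n) (e x)) (ι : TensorData a1 a2 T) :
    ∃ θ : (A.carrier ⊗[K] A.carrier ⧸ IA A.toNu) →ₗ[K] T.carrier,
      (∀ α β (x : L.grading α) (n : N.grading β),
        θ (A.symbol (e x) (d n)) = ι.pair α β x n) ∧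
      (∀ w w', T.bracket (θ (A.mkV w)) (θ (A.mkV w'))
        = θ (A.symbol (TensorProduct.lift brA w) (TensorProduct.lift brA w'))) ∧
      ∀ γ, ∀ v ∈ gradeQuot (gradeTensor A.grading A.grading) (IA A.toNu) γ,
        θ v ∈ T.grading γ := by
  have hpg := A.isPerfectGrading hperf
  obtain ⟨P, hP⟩ := ι.exists_pairing
  have hd_surj : Function.Surjective d := by
    rw [← LinearMap.range_eq_top, eq_top_iff, ← A.isInternal.submodule_iSup_eq_top]
    refine iSup_le fun β b hb => ?_
    obtain ⟨n, -, rfl⟩ := hsurj β b hb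
    exact ⟨n, rfl⟩
  have hPl : ∀ {α α' m m'}, m ∈ L.grading α → m' ∈ L.grading α' → ∀ n,
      P (L.bracket m m') n = P m (a1.act m' n) - ssign α α' • P m' (a1.act m n) := by
    intro α α' m m' hm hm' n
    refine LinearMap.congr_fun (f := P (L.bracket m m'))
      (g := P m ∘ₗ a1.act m' - ssign α α' • P m' ∘ₗ a1.act m)
      (internal_ext N.isInternal fun β n hn => ?_) n
    have := ι.pair_bracket_left α α' β ⟨m, hm⟩ ⟨m', hm'⟩ ⟨n, hn⟩
    simp only [← hP] at this
    exact this
  have hPk : ∀ x n, d n = 0 → P x n = 0 := by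
    intro x n hn
    refine LinearMap.congr_fun (f := P.flip n) (g := 0) (internal_ext L.isInternal
      fun γ x hx => ?_) x
    have key := hpg.induction ⊥ (P.flip n ∘ₗ e.symm.toLinearMap) (γ := γ) ?_ (hgr.1 hx)
    · simpa using key
    · rintro α β a b ha hb -
      obtain ⟨x, rfl⟩ := e.surjective a
      obtain ⟨y, rfl⟩ := e.surjective b
      rw [← hbrA ha hb, ← hbr]
      simp [hPl (hgr.2 ha) (hgr.2 hb), ha1' _ n hn]
  obtain ⟨f, hf⟩ : ∃ f : A.carrier →ₗ[K] A.carrier →ₗ[K] T.carrier,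
      ∀ x n, f (e x) (d n) = P x n := by
    let q := (LinearMap.ker d).liftQ P.flip fun n hn =>
      LinearMap.ext fun x => hPk x n hn
    let E := d.quotKerEquivOfSurjective hd_surj
    refine ⟨(q ∘ₗ E.symm.toLinearMap).flip ∘ₗ e.symm.toLinearMap, fun x n => ?_⟩
    have : E.symm (d n) = (LinearMap.ker d).mkQ n := by
      rw [LinearEquiv.symm_apply_eq]; rfl
    change q (E.symm (d n)) (e.symm (e x)) = P x n
    rw [this, e.symm_apply_apply]
    rfl
  have hcoc : ∀ α β γ, ∀ a ∈ A.grading α, ∀ b ∈ A.grading β, ∀ c ∈ A.grading γ,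
      f (brA a b) c = f a (brA b c) - ssign α β • f b (brA a c) := by
    intro α β γ a ha b hb c hc
    obtain ⟨x, rfl⟩ := e.surjective a
    obtain ⟨y, rfl⟩ := e.surjective b
    obtain ⟨n, rfl⟩ := hd_surj c
    rw [← hbr, ← ha1, ← ha1, hf, hf, hf, hPl (hgr.2 ha) (hgr.2 hb)]
  have hbr_skew : ∀ α β, ∀ a ∈ A.grading α, ∀ b ∈ A.grading β,
      brA a b = -(ssign α β • brA b a) := by
    intro α β a ha b hb
    rw [hbrA ha hb, hbrA hb ha, ssign_comm β α, smul_sub, ssign_smul_smul, neg_sub]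
  have hright : ∀ α β β', ∀ a ∈ A.grading α, ∀ b ∈ A.grading β, ∀ b' ∈ A.grading β',
      f a (brA b b') = ssign β' (α + β) • f (brA b' a) b - ssign α β • f (brA b a) b' := by
    intro α β β' a ha b hb b' hb'
    obtain ⟨x, rfl⟩ := e.surjective a
    obtain ⟨n, hn, rfl⟩ := hsurj β b hb
    obtain ⟨n', hn', rfl⟩ := hsurj β' b' hb'
    have := ι.pair_bracket_right α β β' ⟨x, hgr.2 ha⟩ ⟨n, hn⟩ ⟨n', hn'⟩
    simp only [← hP] at this
    rw [← hdbr, ← ha2, ← ha2, hf, hf, hf, this]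
  have hskew : ∀ α β, ∀ a ∈ A.grading α, ∀ b ∈ A.grading β, f a b = -(ssign α β • f b a) := by
    intro γ β' x hx b' hb'
    rw [eq_neg_iff_add_eq_zero]
    refine (Submodule.mem_bot K).1 (hpg.induction (γ := γ) ⊥
      (f.flip b' + ssign γ β' • f b') ?_ hx)
    rintro α β a b ha hb rfl
    have h1 := hright α β β' a ha b hb b' hb'
    rw [hcoc β' α β b' hb' a ha b hb, hcoc β α β' b hb a ha b' hb',
      hbr_skew β' β b' hb' b hb, map_neg, map_zsmul] at h1
    have h2 := hcoc α β β' a ha b hb b' hb'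
    rw [← hbrA ha hb]
    have k1 : ssign (α + β) β' = ssign β' (α + β) := ssign_comm _ _
    have k2 : ssign β' (α + β) * ssign β' α * ssign β' β = 1 := by
      clear * -; revert α β β'; decide
    have k3 : ssign α β * ssign β α = 1 := by
      clear * -; revert α β; decide
    change f (brA a b) b' + ssign (α + β) β' • f b' (brA a b) = 0
    linear_combination (norm := module) h2 - h1 + k1 • f b' (brA a b)
      - k2 • f a (brA b b') - k3 • f a (brA b b')
  obtain ⟨θ, hθ⟩ := AssocSuperalgebra.exists_lift_of_cocycle hperf f hskew
    fun α β γ a ha b hb c hc => by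
      rw [← hbrA ha hb, ← hbrA hb hc, ← hbrA ha hc, hcoc α β γ a ha b hb c hc]
  have hfP : ∀ α β a (b : N.carrier) (ha : a ∈ A.grading α) (hb : b ∈ N.grading β),
      f a (d b) = ι.pair α β ⟨e.symm a, hgr.2 (by simpa using ha)⟩ ⟨b, hb⟩ := by
    intro α β a b ha hb
    rw [← hP, ← hf, e.apply_symm_apply]
  refine ⟨θ, fun α β x n => ?_, fun w w' => ?_, ?_⟩
  · rw [hθ, hf, hP]
  · let F := θ ∘ₗ A.mkV
    have hF : ∀ a b, F (a ⊗ₜ[K] b) = f a b := hθ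
    let G := TensorProduct.lift brA
    have : T.bracket.compl₁₂ F F = f.compl₁₂ G G := by
      refine internal_tensor_ext A.isInternal A.isInternal fun α β a ha b hb =>
        internal_tensor_ext A.isInternal A.isInternal fun α' β' a' ha' b' hb' => ?_
      obtain ⟨n, hn, rfl⟩ := hsurj β b hb
      obtain ⟨n', hn', rfl⟩ := hsurj β' b' hb'
      obtain ⟨x, rfl⟩ := e.surjective a
      obtain ⟨x', rfl⟩ := e.surjective a'
      have := ι.pair_bracket_pair α β α' β' ⟨x, hgr.2 ha⟩ ⟨n, hn⟩ ⟨x', hgr.2 ha'⟩ ⟨n', hn'⟩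
      simp only [← hP, ← hf, ha2, ha1] at this
      rw [LinearMap.compl₁₂_apply, hF, hF]
      change T.bracket (f (e x) (d n)) (f (e x') (d n'))
        = f (brA (e x) (d n)) (brA (e x') (d n'))
      rw [this, hbr_skew α β _ ha _ hb, map_neg, map_zsmul]
      rfl
    rw [hθ]
    exact LinearMap.congr_fun₂ this w w'
  · rintro γ _ ⟨t, ht, rfl⟩
    have : gradeTensor A.grading A.grading γ
        ≤ (T.grading γ).comap (θ ∘ₗ A.mkV) := by
      refine Submodule.span_le.2 ?_
      rintro _ ⟨α, β, a, b, rfl, ha, hb, rfl⟩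
      obtain ⟨n, hn, rfl⟩ := hsurj β b hb
      change θ (A.symbol a (d n)) ∈ T.grading (α + β)
      rw [hθ, hfP α β a n ha hn]
      exact ι.pair_grading _ _ _ _
    exact this ht

theorem AssocSuperalgebra.exists_homology_bijective {A : AssocSuperalgebra K}
    (hperf : commSpan A.toNu = ⊤)
    {brA : A.carrier →ₗ[K] A.carrier →ₗ[K] A.carrier}
    (hbrA : ∀ {α β a b}, a ∈ A.grading α → b ∈ A.grading β →
      brA a b = a * b - ssign α β • (b * a))
    {L : LieSuperalgebra K} {e : L.carrier ≃ₗ[K] A.carrier}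
    (hgr : ∀ {α x}, x ∈ L.grading α ↔ e x ∈ A.grading α)
    (hbr : ∀ x y, e (L.bracket x y) = brA (e x) (e y))
    {cbar : (A.carrier ⊗[K] A.carrier ⧸ IA A.toNu) →ₗ[K] A.carrier}
    (hcbar : ∀ a b, cbar (A.symbol a b) = brA a b)
    {d₂ : (L.carrier ⊗[K] L.carrier ⧸ altRel L) →ₗ[K] L.carrier}
    (hd₂ : ∀ (α β : ZMod 2) (x : L.grading α) (y : L.grading β),
      d₂ ((altRel L).mkQ (x.1 ⊗ₜ[K] y.1)) = -(L.bracket x.1 y.1))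
    {d₃ : (L.carrier ⊗[K] (L.carrier ⊗[K] L.carrier) ⧸ altRel3 L) →ₗ[K]
      (L.carrier ⊗[K] L.carrier ⧸ altRel L)}
    (hd₃ : ∀ (α β γ : ZMod 2) (x : L.grading α) (y : L.grading β) (z : L.grading γ),
      d₃ ((altRel3 L).mkQ (x.1 ⊗ₜ[K] (y.1 ⊗ₜ[K] z.1)))
        = -((altRel L).mkQ ((L.bracket x.1 y.1) ⊗ₜ[K] z.1))
          + ssign β γ • (altRel L).mkQ ((L.bracket x.1 z.1) ⊗ₜ[K] y.1)
          - ssign α (β + γ) • (altRel L).mkQ ((L.bracket y.1 z.1) ⊗ₜ[K] x.1)) :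
    ∃ ψ : (LinearMap.ker d₂ ⧸
        Submodule.comap (LinearMap.ker d₂).subtype (LinearMap.range d₃)) →ₗ[K]
      (LinearMap.ker cbar : Submodule K (A.carrier ⊗[K] A.carrier ⧸ IA A.toNu)),
      Function.Bijective ψ := by
  let h : L.carrier →ₗ[K] L.carrier →ₗ[K] (L.carrier ⊗[K] L.carrier ⧸ altRel L) :=
    (TensorProduct.mk K L.carrier L.carrier).compr₂ (altRel L).mkQ
  have hskew : ∀ α β, ∀ x ∈ L.grading α, ∀ y ∈ L.grading β, h x y = -(ssign α β • h y x) := by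
    intro α β x hx y hy
    rw [eq_neg_iff_add_eq_zero]
    refine (Submodule.Quotient.mk_eq_zero (altRel L)).2 (Submodule.subset_span ?_)
    exact ⟨α, β, ⟨x, hx⟩, ⟨y, hy⟩, rfl⟩
  let p := (LinearMap.range d₃).mkQ
  obtain ⟨θ, hθ⟩ := AssocSuperalgebra.exists_lift_of_cocycle hperf
    ((h.compr₂ p).compl₁₂ e.symm.toLinearMap e.symm.toLinearMap)
    (fun α β a ha b hb => by
      obtain ⟨x, rfl⟩ := e.surjective a
      obtain ⟨y, rfl⟩ := e.surjective b
      simp only [LinearMap.compl₁₂_apply, LinearMap.compr₂_apply, LinearEquiv.coe_coe,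
        e.symm_apply_apply]
      rw [hskew α β x (hgr.2 ha) y (hgr.2 hb), map_neg, map_zsmul])
    (fun α β γ a ha b hb c hc => by
      rw [← hbrA ha hb, ← hbrA hb hc, ← hbrA ha hc]
      obtain ⟨x, rfl⟩ := e.surjective a
      obtain ⟨y, rfl⟩ := e.surjective b
      obtain ⟨z, rfl⟩ := e.surjective c
      have hx := hgr.2 ha
      have hy := hgr.2 hb
      have hz := hgr.2 hc
      simp only [← hbr, LinearMap.compl₁₂_apply, LinearMap.compr₂_apply, LinearEquiv.coe_coe,
        e.symm_apply_apply]
      have h1 : p (d₃ ((altRel3 L).mkQ (x ⊗ₜ[K] (y ⊗ₜ[K] z)))) = 0 :=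
        (Submodule.Quotient.mk_eq_zero (LinearMap.range d₃)).2 ⟨_, rfl⟩
      have h2 : d₃ ((altRel3 L).mkQ (x ⊗ₜ[K] (y ⊗ₜ[K] z))) = -h (L.bracket x y) z
          + ssign β γ • h (L.bracket x z) y - ssign α (β + γ) • h (L.bracket y z) x :=
        hd₃ α β γ ⟨x, hx⟩ ⟨y, hy⟩ ⟨z, hz⟩
      rw [h2, map_sub, map_add, map_neg, map_zsmul, map_zsmul] at h1
      rw [hskew α _ x hx _ (L.bracket_grading _ _ _ _ hy hz),
        hskew β _ y hy _ (L.bracket_grading _ _ _ _ hx hz)]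
      simp only [map_neg, map_zsmul]
      have k : ssign α β * ssign β (α + γ) = ssign β γ := by
        clear * -; revert α β γ; decide
      linear_combination (norm := module) -h1 - k • p (h (L.bracket x z) y))
  let S : L.carrier →ₗ[K] L.carrier →ₗ[K] (A.carrier ⊗[K] A.carrier ⧸ IA A.toNu) :=
    ((TensorProduct.mk K A.carrier A.carrier).compr₂ A.mkV).compl₁₂
      e.toLinearMap e.toLinearMap
  have hS : ∀ x y, S x y = A.symbol (e x) (e y) := fun x y => rfl
  let Φ : (L.carrier ⊗[K] L.carrier ⧸ altRel L) →ₗ[K] (A.carrier ⊗[K] A.carrier ⧸ IA A.toNu) :=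
    (altRel L).liftQ (TensorProduct.lift S) <| Submodule.span_le.2 <| by
      rintro _ ⟨α, β, ⟨x, hx⟩, ⟨y, hy⟩, rfl⟩
      change TensorProduct.lift S (x ⊗ₜ[K] y + ssign α β • (y ⊗ₜ[K] x)) = 0
      rw [map_add, map_zsmul, TensorProduct.lift.tmul, TensorProduct.lift.tmul, hS, hS,
        symbol_skew (hgr.1 hx) (hgr.1 hy), neg_add_cancel]
  have hΦ : ∀ x y, Φ (h x y) = A.symbol (e x) (e y) := fun x y => rfl
  have hΦd : ∀ w, Φ (d₃ w) = 0 := by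
    intro w
    obtain ⟨w, rfl⟩ := (altRel3 L).mkQ_surjective w
    refine LinearMap.congr_fun (f := Φ ∘ₗ d₃ ∘ₗ (altRel3 L).mkQ) (g := 0)
      (TensorProduct.ext (internal_ext L.isInternal fun α x hx =>
        internal_tensor_ext L.isInternal L.isInternal fun β γ y hy z hz => ?_)) w
    have h2 : d₃ ((altRel3 L).mkQ (x ⊗ₜ[K] (y ⊗ₜ[K] z))) = -h (L.bracket x y) z
        + ssign β γ • h (L.bracket x z) y - ssign α (β + γ) • h (L.bracket y z) x :=
      hd₃ α β γ ⟨x, hx⟩ ⟨y, hy⟩ ⟨z, hz⟩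
    change Φ (d₃ ((altRel3 L).mkQ (x ⊗ₜ[K] (y ⊗ₜ[K] z)))) = 0
    rw [h2, map_sub, map_add, map_neg, map_zsmul, map_zsmul, hΦ, hΦ, hΦ, hbr, hbr, hbr,
      hbrA (hgr.1 hx) (hgr.1 hy), hbrA (hgr.1 hx) (hgr.1 hz), hbrA (hgr.1 hy) (hgr.1 hz)]
    exact symbol_jacobi (hgr.1 hx) (hgr.1 hy) (hgr.1 hz)
  have hθΦ : ∀ w, θ (Φ w) = p w := by
    intro w
    obtain ⟨w, rfl⟩ := (altRel L).mkQ_surjective w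
    refine LinearMap.congr_fun (f := θ ∘ₗ Φ ∘ₗ (altRel L).mkQ) (g := p ∘ₗ (altRel L).mkQ)
      (TensorProduct.ext' fun x y => ?_) w
    change θ (Φ (h x y)) = p (h x y)
    rw [hΦ, hθ]
    simp
  have hcΦ : ∀ w, cbar (Φ w) = -e (d₂ w) := by
    intro w
    obtain ⟨w, rfl⟩ := (altRel L).mkQ_surjective w
    refine LinearMap.congr_fun (f := cbar ∘ₗ Φ ∘ₗ (altRel L).mkQ)
      (g := -(e.toLinearMap ∘ₗ d₂ ∘ₗ (altRel L).mkQ))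
      (internal_tensor_ext L.isInternal L.isInternal fun α β x hx y hy => ?_) w
    change cbar (Φ (h x y)) = -e (d₂ ((altRel L).mkQ (x ⊗ₜ[K] y)))
    rw [hd₂ α β ⟨x, hx⟩ ⟨y, hy⟩, hΦ, hcbar, map_neg, neg_neg, hbr]
  have hΦ_surj : Function.Surjective Φ := by
    intro v
    obtain ⟨w, rfl⟩ := A.mkV_surjective v
    refine ⟨(altRel L).mkQ (TensorProduct.map e.symm.toLinearMap e.symm.toLinearMap w), ?_⟩
    refine LinearMap.congr_fun (f := Φ ∘ₗ (altRel L).mkQ ∘ₗ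
      TensorProduct.map e.symm.toLinearMap e.symm.toLinearMap) (g := A.mkV)
      (TensorProduct.ext' fun a b => ?_) w
    change Φ (h (e.symm a) (e.symm b)) = A.symbol a b
    rw [hΦ, e.apply_symm_apply, e.apply_symm_apply]
  let Ψ : LinearMap.ker d₂ →ₗ[K] LinearMap.ker cbar :=
    (Φ ∘ₗ (LinearMap.ker d₂).subtype).codRestrict (LinearMap.ker cbar) fun w => by
      rw [LinearMap.mem_ker, LinearMap.comp_apply, Submodule.subtype_apply, hcΦ,
        LinearMap.mem_ker.1 w.2, map_zero, neg_zero]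
  have hΨ : ∀ w, (Ψ w).1 = Φ w.1 := fun w => rfl
  refine ⟨Submodule.liftQ _ Ψ ?_, ?_, ?_⟩
  · rintro w ⟨v, hv⟩
    rw [LinearMap.mem_ker, Subtype.ext_iff, hΨ]
    exact (congrArg Φ hv).symm.trans (hΦd v)
  · rw [injective_iff_map_eq_zero]
    intro w hw
    obtain ⟨w, rfl⟩ := Submodule.mkQ_surjective _ w
    refine (Submodule.Quotient.mk_eq_zero _).2 ?_
    have h0 : Φ w.1 = 0 := congrArg Subtype.val hw
    have := hθΦ w.1
    rw [h0, map_zero] at this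
    exact (Submodule.Quotient.mk_eq_zero (LinearMap.range d₃)).1 this.symm
  · rintro ⟨v, hv⟩
    obtain ⟨w, rfl⟩ := hΦ_surj v
    have hw : w ∈ LinearMap.ker d₂ := by
      rw [LinearMap.mem_ker, hcΦ, neg_eq_zero] at hv
      simpa using hv
    exact ⟨Submodule.mkQ _ ⟨w, hw⟩, Subtype.ext (hΨ ⟨w, hw⟩)⟩

theorem IsNATensor.ker_eq_bot {M N T Q : LieSuperalgebra K} {a1 : LieSuperAction M N}
    {a2 : LieSuperAction N M} {ι : TensorData a1 a2 T} (h : IsNATensor a1 a2 T ι)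
    (ν : LieSuperHom T Q) (κ : LieSuperHom Q T)
    (hκ : ∀ α β (m : M.grading α) (n : N.grading β),
      κ.toLinear (ν.toLinear (ι.pair α β m n)) = ι.pair α β m n) :
    LinearMap.ker ν.toLinear = ⊥ := by
  have key : (⟨κ.toLinear ∘ₗ ν.toLinear,
      fun α x hx => κ.map_grading α _ (ν.map_grading α x hx),
      fun x y => by
        simp only [LinearMap.comp_apply, ν.map_bracket, κ.map_bracket]⟩ : LieSuperHom T T)
      = ⟨LinearMap.id, fun _ _ hx => hx, fun _ _ => rfl⟩ :=
    (h T ι).unique hκ fun _ _ _ _ => rfl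
  refine LinearMap.ker_eq_bot_of_inverse (g := κ.toLinear) ?_
  exact congrArg LieSuperHom.toLinear key

theorem mem_grading_iff {V W : Type} [AddCommGroup V] [Module K V] [AddCommGroup W] [Module K W]
    {g : ZMod 2 → Submodule K V} {g' : ZMod 2 → Submodule K W} {e : V ≃ₗ[K] W}
    (h : SuperEquiv g g' e) {α : ZMod 2} {x : V} : x ∈ g α ↔ e x ∈ g' α := by
  rw [← h α, Submodule.mem_map_equiv, e.symm_apply_apply]

namespace AssocSuperalgebra

variable {A : AssocSuperalgebra K}

theorem subsingleton_quotient_JA (hperf : commSpan A.toNu = ⊤) :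
    Subsingleton (A.carrier ⊗[K] A.carrier ⧸ JA A.toNu) := by
  let q : A.carrier ⊗[K] A.carrier →ₗ[K] A.carrier ⊗[K] A.carrier ⧸ JA A.toNu :=
    (JA A.toNu).mkQ
  have hq : q = 0 := by
    refine internal_tensor_ext A.isInternal A.isInternal fun α γ a ha x hx => ?_
    refine (Submodule.mem_bot K).1 ((A.isPerfectGrading hperf).induction ⊥
      (q ∘ₗ TensorProduct.mk K A.carrier A.carrier a) ?_ hx)
    rintro β β' b b' hb hb' -
    rw [map_sub, map_zsmul]
    change q (a ⊗ₜ[K] (b * b')) - ssign β β' • q (a ⊗ₜ[K] (b' * b)) ∈ _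
    rw [← map_zsmul, ← map_sub, Submodule.mem_bot]
    refine (Submodule.Quotient.mk_eq_zero (JA A.toNu)).2 (Submodule.subset_span (Or.inr ?_))
    exact ⟨α, β, β', ⟨a, ha⟩, ⟨b, hb⟩, ⟨b', hb'⟩, rfl⟩
  refine subsingleton_of_forall_eq 0 fun v => ?_
  obtain ⟨w, rfl⟩ := (JA A.toNu).mkQ_surjective v
  exact LinearMap.congr_fun hq w

theorem subsingleton_quotient_commSpan2 (hperf : commSpan A.toNu = ⊤)
    {brA : A.carrier →ₗ[K] A.carrier →ₗ[K] A.carrier}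
    (hbrA : ∀ {α β a b}, a ∈ A.grading α → b ∈ A.grading β →
      brA a b = a * b - ssign α β • (b * a)) :
    Subsingleton ((commSpan A.toNu : Submodule K A.carrier) ⧸
      Submodule.comap (commSpan A.toNu).subtype (commSpan2 A.toNu brA)) := by
  rw [Submodule.Quotient.subsingleton_iff, eq_top_iff]
  rintro ⟨x, hx⟩ -
  refine (Submodule.span_le.2 ?_ : commSpan A.toNu ≤ commSpan2 A.toNu brA) hx
  rintro _ ⟨α, β, ⟨a, ha⟩, ⟨b, hb⟩, rfl⟩
  refine Submodule.subset_span ⟨a, b, ?_, (hbrA ha hb).symm⟩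
  rw [hperf]
  trivial

theorem symbol_zero_right (a : A.carrier) : A.symbol a 0 = 0 := by
  exact map_zero (A.mkV ∘ₗ TensorProduct.mk K A.carrier A.carrier a)

theorem symbol_mem {α β : ZMod 2} {a b : A.carrier} (ha : a ∈ A.grading α)
    (hb : b ∈ A.grading β) :
    A.symbol a b ∈ gradeQuot (gradeTensor A.grading A.grading) (IA A.toNu) (α + β) :=
  ⟨a ⊗ₜ[K] b, Submodule.subset_span ⟨α, β, a, b, rfl, ha, hb, rfl⟩, rfl⟩

end AssocSuperalgebra

/-- If the unital associative superalgebra `A` is perfect as a Lie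
superalgebra, there is a short exact sequence `0 → H̄₁(A,V(A)) → H₂(A) → HC₁(A) → 0`;
if moreover `H₂(A) = 0`, all six terms of the six-term exact sequence of Statement 14
are trivial. -/
theorem statement15 {K : Type} [CommRing K] (A : AssocSuperalgebra K)
    -- the super-commutator bracket of `A`
    (brA : A.carrier →ₗ[K] A.carrier →ₗ[K] A.carrier)
    (hbrA : ∀ (α β : ZMod 2) (a : A.grading α) (b : A.grading β),
      brA a.1 b.1 = a.1 * b.1 - ssign α β • (b.1 * a.1))
    -- `A` is perfect as a Lie superalgebra: `A = [A,A]`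
    (hperf : commSpan A.toNu = ⊤)
    -- `A` regarded as a Lie superalgebra
    (LA : LieSuperalgebra K) (eA : LA.carrier ≃ₗ[K] A.carrier)
    (hLAgr : ∀ γ : ZMod 2, (LA.grading γ).map eA.toLinearMap = A.grading γ)
    (hLAbr : ∀ x y : LA.carrier, eA (LA.bracket x y) = brA (eA x) (eA y))
    -- the linear map `A ⊗_K A → A`, `a ⊗ b ↦ [a,b]`
    (c : A.carrier ⊗[K] A.carrier →ₗ[K] A.carrier)
    (hc : ∀ a b : A.carrier, c (a ⊗ₜ[K] b) = brA a b)
    -- `V(A)`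
    (VA : LieSuperalgebra K)
    (eV : VA.carrier ≃ₗ[K] (A.carrier ⊗[K] A.carrier ⧸ IA A.toNu))
    (hVgr : ∀ γ : ZMod 2, (VA.grading γ).map eV.toLinearMap
      = gradeQuot (gradeTensor A.grading A.grading) (IA A.toNu) γ)
    (hVbr : ∀ w w' : A.carrier ⊗[K] A.carrier,
      eV (VA.bracket (eV.symm ((IA A.toNu).mkQ w)) (eV.symm ((IA A.toNu).mkQ w')))
        = (IA A.toNu).mkQ ((c w) ⊗ₜ[K] (c w')))
    (cbar : (A.carrier ⊗[K] A.carrier ⧸ IA A.toNu) →ₗ[K] A.carrier)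
    (hcbar : ∀ w : A.carrier ⊗[K] A.carrier, cbar ((IA A.toNu).mkQ w) = c w)
    -- `[A,A]` regarded as a Lie superalgebra
    (CA : LieSuperalgebra K) (eC : CA.carrier ≃ₗ[K] commSpan A.toNu)
    (hCgr : ∀ γ : ZMod 2, (CA.grading γ).map eC.toLinearMap
      = gradeSub A.grading (commSpan A.toNu) γ)
    (hCbr : ∀ x y : CA.carrier, (eC (CA.bracket x y)).1 = brA (eC x).1 (eC y).1)
    -- the crossed-module actions
    (a1 : LieSuperAction LA VA) (a2 : LieSuperAction VA LA)
    (ha1 : ∀ (x : LA.carrier) (w : A.carrier ⊗[K] A.carrier),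
      a1.act x (eV.symm ((IA A.toNu).mkQ w))
        = eV.symm ((IA A.toNu).mkQ ((eA x) ⊗ₜ[K] (c w))))
    (ha2 : ∀ (w : A.carrier ⊗[K] A.carrier) (x : LA.carrier),
      a2.act (eV.symm ((IA A.toNu).mkQ w)) x = eA.symm (brA (c w) (eA x)))
    (aLC : LieSuperAction LA CA)
    (haLC : ∀ (x : LA.carrier) (y : CA.carrier),
      (eC (aLC.act x y)).1 = brA (eA x) (eC y).1)
    (aCL : LieSuperAction CA LA)
    (haCL : ∀ (y : CA.carrier) (x : LA.carrier),
      aCL.act y x = eA.symm (brA (eC y).1 (eA x)))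
    -- the non-abelian tensor products `A ⊗ V(A)` and `A ⊗ [A,A]`
    (T₂ : LieSuperalgebra K) (ι₂ : TensorData a1 a2 T₂) (h₂ : IsNATensor a1 a2 T₂ ι₂)
    (T₃ : LieSuperalgebra K) (ι₃ : TensorData aLC aCL T₃) (h₃ : IsNATensor aLC aCL T₃ ι₃)
    (ν₂ : LieSuperHom T₂ VA)
    (hν₂ : ∀ (α β : ZMod 2) (p : LA.grading α) (v : VA.grading β),
      ν₂.toLinear (ι₂.pair α β p v) = a1.act p.1 v.1)
    (ν₃ : LieSuperHom T₃ CA)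
    (hν₃ : ∀ (α β : ZMod 2) (p : LA.grading α) (v : CA.grading β),
      ν₃.toLinear (ι₃.pair α β p v) = aLC.act p.1 v.1)
    -- the Chevalley–Eilenberg boundary maps of `A` with trivial coefficients
    (d₂ : (LA.carrier ⊗[K] LA.carrier ⧸ altRel LA) →ₗ[K] LA.carrier)
    (hd₂ : ∀ (α β : ZMod 2) (x : LA.grading α) (y : LA.grading β),
      d₂ ((altRel LA).mkQ (x.1 ⊗ₜ[K] y.1)) = -(LA.bracket x.1 y.1))
    (d₃ : (LA.carrier ⊗[K] (LA.carrier ⊗[K] LA.carrier) ⧸ altRel3 LA) →ₗ[K]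
          (LA.carrier ⊗[K] LA.carrier ⧸ altRel LA))
    (hd₃ : ∀ (α β γ : ZMod 2) (x : LA.grading α) (y : LA.grading β) (z : LA.grading γ),
      d₃ ((altRel3 LA).mkQ (x.1 ⊗ₜ[K] (y.1 ⊗ₜ[K] z.1)))
        = -((altRel LA).mkQ ((LA.bracket x.1 y.1) ⊗ₜ[K] z.1))
          + ssign β γ • (altRel LA).mkQ ((LA.bracket x.1 z.1) ⊗ₜ[K] y.1)
          - ssign α (β + γ) • (altRel LA).mkQ ((LA.bracket y.1 z.1) ⊗ₜ[K] x.1)) :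
    -- the short exact sequence `0 → H̄₁(A,V(A)) → H₂(A) → HC₁(A) → 0`
    (∃ (φ : (LinearMap.ker ν₂.toLinear : Submodule K T₂.carrier) →ₗ[K]
          (LinearMap.ker d₂ ⧸
            Submodule.comap (LinearMap.ker d₂).subtype (LinearMap.range d₃)))
      (ψ : (LinearMap.ker d₂ ⧸
            Submodule.comap (LinearMap.ker d₂).subtype (LinearMap.range d₃)) →ₗ[K]
          (LinearMap.ker cbar :
            Submodule K (A.carrier ⊗[K] A.carrier ⧸ IA A.toNu))),
      Function.Injective φ ∧
      LinearMap.range φ = LinearMap.ker ψ ∧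
      Function.Surjective ψ) ∧
    -- if moreover `H₂(A) = 0`, all terms of the six-term exact sequence are trivial
    (Subsingleton (LinearMap.ker d₂ ⧸
        Submodule.comap (LinearMap.ker d₂).subtype (LinearMap.range d₃)) →
      Subsingleton ((A.carrier ⧸ commSpan A.toNu) ⊗[K] LinearMap.ker cbar) ∧
      Subsingleton (LinearMap.ker ν₂.toLinear : Submodule K T₂.carrier) ∧
      Subsingleton (LinearMap.ker ν₃.toLinear : Submodule K T₃.carrier) ∧
      Subsingleton (LinearMap.ker cbar :
        Submodule K (A.carrier ⊗[K] A.carrier ⧸ IA A.toNu)) ∧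
      Subsingleton (A.carrier ⊗[K] A.carrier ⧸ JA A.toNu) ∧
      Subsingleton ((commSpan A.toNu : Submodule K A.carrier) ⧸
        Submodule.comap (commSpan A.toNu).subtype (commSpan2 A.toNu brA))) := by
  have hbr {α β a b} (ha : a ∈ A.grading α) (hb : b ∈ A.grading β) :
      brA a b = a * b - ssign α β • (b * a) := hbrA α β ⟨a, ha⟩ ⟨b, hb⟩
  obtain rfl : c = TensorProduct.lift brA := TensorProduct.ext' fun a b => by
    rw [hc, TensorProduct.lift.tmul]
  have hLgr {α : ZMod 2} {x : LA.carrier} : x ∈ LA.grading α ↔ eA x ∈ A.grading α :=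
    mem_grading_iff hLAgr
  have hcs (a b : A.carrier) : cbar (A.symbol a b) = brA a b := (hcbar _).trans (hc a b)
  have hcv (w : A.carrier ⊗[K] A.carrier) : cbar (A.mkV w) = TensorProduct.lift brA w :=
    hcbar w
  have hV (n : VA.carrier) : ∃ w : A.carrier ⊗[K] A.carrier,
      n = eV.symm (A.mkV w) ∧ cbar (eV n) = TensorProduct.lift brA w := by
    obtain ⟨w, hw⟩ := A.mkV_surjective (eV n)
    exact ⟨w, by rw [eV.eq_symm_apply, hw], by rw [← hw, hcv]⟩
  have hVsurj (β : ZMod 2) (b : A.carrier) (hb : b ∈ A.grading β) :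
      ∃ n ∈ VA.grading β, cbar (eV n) = b := by
    refine (A.isPerfectGrading hperf).induction
      ((VA.grading β).map (cbar ∘ₗ eV.toLinearMap)) LinearMap.id ?_ hb
    rintro α β a b' ha hb' rfl
    refine ⟨eV.symm (A.symbol a b'), ?_, ?_⟩
    · refine (mem_grading_iff hVgr).2 ?_
      rw [eV.apply_symm_apply]
      exact AssocSuperalgebra.symbol_mem ha hb'
    · change cbar (eV (eV.symm (A.symbol a b'))) = _
      rw [eV.apply_symm_apply, hcs, hbr ha hb', LinearMap.id_apply]
  have hVmk (w w' : A.carrier ⊗[K] A.carrier) :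
      eV (VA.bracket (eV.symm (A.mkV w)) (eV.symm (A.mkV w')))
        = A.symbol (TensorProduct.lift brA w) (TensorProduct.lift brA w') := hVbr w w'
  have hV1 (x : LA.carrier) (n : VA.carrier) :
      a1.act x n = eV.symm (A.symbol (eA x) (cbar (eV n))) := by
    obtain ⟨w, rfl, hw⟩ := hV n
    rw [hw]
    exact ha1 x w
  obtain ⟨ψ, hψ⟩ := AssocSuperalgebra.exists_homology_bijective hperf hbr hLgr hLAbr hcs hd₂ hd₃
  have hker₂ : LinearMap.ker ν₂.toLinear = ⊥ := by
    obtain ⟨θ, hθ, hθbr, hθgr⟩ := ι₂.exists_lift hperf hbr hLgr hLAbr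
      (d := cbar ∘ₗ eV.toLinearMap) hVsurj
      (fun n n' => by
        obtain ⟨w, rfl, hw⟩ := hV n
        obtain ⟨w', rfl, hw'⟩ := hV n'
        simp only [LinearMap.comp_apply, LinearEquiv.coe_coe]
        rw [hVmk, hcs, hw, hw'])
      (fun x n => by
        simp only [LinearMap.comp_apply, LinearEquiv.coe_coe]
        rw [hV1, eV.apply_symm_apply, hcs])
      (fun x n hn => by
        simp only [LinearMap.comp_apply, LinearEquiv.coe_coe] at hn
        rw [hV1, hn, AssocSuperalgebra.symbol_zero_right, map_zero])
      (fun n x => by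
        obtain ⟨w, rfl, hw⟩ := hV n
        simp only [LinearMap.comp_apply, LinearEquiv.coe_coe]
        rw [hw]
        exact eA.eq_symm_apply.1 (ha2 w x))
    refine h₂.ker_eq_bot ν₂ ⟨θ ∘ₗ eV.toLinearMap, fun γ n hn => ?_, fun n n' => ?_⟩
      fun α β m n => ?_
    · exact hθgr γ _ ((mem_grading_iff hVgr).1 hn)
    · obtain ⟨w, rfl, -⟩ := hV n
      obtain ⟨w', rfl, -⟩ := hV n'
      simp only [LinearMap.comp_apply, LinearEquiv.coe_coe]
      rw [hVmk, eV.apply_symm_apply, eV.apply_symm_apply, hθbr]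
    · rw [hν₂, hV1, ← hθ]
      simp
  refine ⟨⟨0, ψ, ?_, ?_, hψ.2⟩, fun hH => ?_⟩
  · rw [hker₂]
    exact Function.injective_of_subsingleton _
  · rw [LinearMap.range_zero, LinearMap.ker_eq_bot.2 hψ.1]
  have hcbot : LinearMap.ker cbar = ⊥ :=
    (Submodule.subsingleton_iff_eq_bot).1 hψ.2.subsingleton
  refine ⟨?_, ?_, ?_, hψ.2.subsingleton, AssocSuperalgebra.subsingleton_quotient_JA hperf,
    AssocSuperalgebra.subsingleton_quotient_commSpan2 hperf hbr⟩
  · have : Subsingleton (A.carrier ⧸ commSpan A.toNu) :=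
      Submodule.Quotient.subsingleton_iff.2 hperf
    refine subsingleton_of_forall_eq 0 fun t => ?_
    refine LinearMap.congr_fun (f := LinearMap.id) (g := 0) (TensorProduct.ext' fun x y => ?_) t
    rw [Subsingleton.elim x 0, TensorProduct.zero_tmul, map_zero, map_zero]
  · rw [Submodule.subsingleton_iff_eq_bot, hker₂]
  rw [Submodule.subsingleton_iff_eq_bot]
  have hcsurj : Function.Surjective cbar := by
    rw [← LinearMap.range_eq_top, eq_top_iff, ← A.isInternal.submodule_iSup_eq_top]
    refine iSup_le fun β b hb => ?_
    obtain ⟨n, -, hn⟩ := hVsurj β b hb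
    exact ⟨_, hn⟩
  let E := LinearEquiv.ofBijective cbar ⟨LinearMap.ker_eq_bot.1 hcbot, hcsurj⟩
  have hE (v) : E.symm (cbar v) = v := E.symm_apply_apply v
  have hEbr (a b : A.carrier) : E.symm (brA a b) = A.symbol a b := by rw [← hcs, hE]
  let d : CA.carrier →ₗ[K] A.carrier := (commSpan A.toNu).subtype ∘ₗ eC.toLinearMap
  have hd1 (x : LA.carrier) (n : CA.carrier) : d (aLC.act x n) = brA (eA x) (d n) := haLC x n
  have hdbr (n n' : CA.carrier) : d (CA.bracket n n') = brA (d n) (d n') := hCbr n n'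
  have hdinj : Function.Injective d := Subtype.val_injective.comp eC.injective
  obtain ⟨θ, hθ, hθbr, hθgr⟩ := ι₃.exists_lift hperf hbr hLgr hLAbr (d := d)
    (fun β b hb => by
      refine ⟨eC.symm ⟨b, hperf ▸ trivial⟩, (mem_grading_iff hCgr).2 ?_, ?_⟩
      · rw [eC.apply_symm_apply]
        exact hb
      · exact congrArg Subtype.val (eC.apply_symm_apply ⟨b, hperf ▸ trivial⟩))
    hdbr hd1 (fun x n hn => hdinj (by rw [hd1, hn, map_zero, map_zero]))
    (fun n x => by
      rw [haCL, eA.apply_symm_apply]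
      rfl)
  refine h₃.ker_eq_bot ν₃ ⟨θ ∘ₗ E.symm.toLinearMap ∘ₗ d, fun γ n hn => ?_, fun n n' => ?_⟩
    fun α β m n => ?_
  · obtain ⟨v, hv, hvn⟩ := hVsurj γ (d n) ((mem_grading_iff hCgr).1 hn)
    simp only [LinearMap.comp_apply, LinearEquiv.coe_coe]
    rw [← hvn, hE]
    exact hθgr γ _ ((mem_grading_iff hVgr).1 hv)
  · obtain ⟨v, hv⟩ := hcsurj (d n)
    obtain ⟨v', hv'⟩ := hcsurj (d n')
    obtain ⟨w, rfl⟩ := A.mkV_surjective v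
    obtain ⟨w', rfl⟩ := A.mkV_surjective v'
    simp only [LinearMap.comp_apply, LinearEquiv.coe_coe]
    rw [hdbr, hEbr, ← hv, ← hv', hE, hE, hθbr, hcv, hcv]
  · simp only [LinearMap.comp_apply, LinearEquiv.coe_coe]
    rw [hν₃, hd1, hEbr, hθ]


end SuperNA
end

section
/- Let P be a Lie superalgebra over a commutative unital ring K and let (M,∂) and (N,∂′) be crossed P-modules, acting on each other via P. Let M □ N be the graded submodule of the non-abelian tensor product M ⊗ N generated by the elements (a) m ⊗ n + (−1)^{|m′||n′|} m′ ⊗ n′ whenever ∂(m) = ∂′(n′) and ∂(m′) = ∂′(n), and (b) m₀ ⊗ n₀ whenever m₀, n₀ are even and ∂(m₀) = ∂′(n₀) (m, m′ ∈ M and n, n′ ∈ N homogeneous). Then M □ N is a graded ideal of M ⊗ N contained in the centre of M ⊗ N. -/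
open scoped TensorProduct

namespace SuperNA

variable {K : Type} [CommRing K]

section GradedSubmodule

variable {V : Type} [AddCommGroup V] [Module K V]

theorem iSup_zmod_two (g : ZMod 2 → Submodule K V) : ⨆ α, g α = g 0 ⊔ g 1 := by
  apply le_antisymm
  · refine iSup_le fun α => ?_
    fin_cases α
    · exact le_sup_left
    · exact le_sup_right
  · exact sup_le (le_iSup g 0) (le_iSup g 1)

theorem isInternal_gradeSub {g : ZMod 2 → Submodule K V} (hg : DirectSum.IsInternal g)
    {S : Submodule K V} (hS : S ≤ ⨆ α, S ⊓ g α) : DirectSum.IsInternal (gradeSub g S) := by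
  have huniv : (Set.univ : Set (ZMod 2)) = {0, 1} := by
    ext α
    simp only [Set.mem_univ, Set.mem_insert_iff, Set.mem_singleton_iff, true_iff]
    revert α
    decide
  have hne : (0 : ZMod 2) ≠ 1 := by decide
  rw [DirectSum.isInternal_submodule_iff_isCompl _ hne huniv] at hg ⊢
  refine ⟨Submodule.disjoint_def.2 fun x h0 h1 => Subtype.ext ?_,
    codisjoint_iff.2 (eq_top_iff.2 fun x _ => ?_)⟩
  · exact Submodule.disjoint_def.1 hg.disjoint x.1 h0 h1
  · have hx := hS x.2
    rw [iSup_zmod_two] at hx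
    obtain ⟨a, ha, b, hb, hab⟩ := Submodule.mem_sup.1 hx
    exact Submodule.mem_sup.2 ⟨⟨a, ha.1⟩, ha.2, ⟨b, hb.1⟩, hb.2, Subtype.ext hab⟩

theorem span_le_iSup_inf {g : ZMod 2 → Submodule K V} {s : Set V}
    (hs : ∀ x ∈ s, ∃ α, x ∈ g α) :
    Submodule.span K s ≤ ⨆ α, Submodule.span K s ⊓ g α := by
  refine Submodule.span_le.2 fun x hx => ?_
  obtain ⟨α, hα⟩ := hs x hx
  exact Submodule.mem_iSup_of_mem α ⟨Submodule.subset_span hx, hα⟩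

end GradedSubmodule

/-- The Lie superalgebra structure on a graded submodule closed under the bracket. -/
def LieSuperalgebra.restrict (L : LieSuperalgebra K) (S : Submodule K L.carrier)
    (hgr : S ≤ ⨆ α, S ⊓ L.grading α) (hbr : ∀ x ∈ S, ∀ y ∈ S, L.bracket x y ∈ S) :
    LieSuperalgebra K where
  carrier := S
  grading := gradeSub L.grading S
  isInternal := isInternal_gradeSub L.isInternal hgr
  bracket := LinearMap.mk₂ K (fun x y => ⟨L.bracket x.1 y.1, hbr _ x.2 _ y.2⟩)
    (fun _ _ _ => Subtype.ext (by simp)) (fun _ _ _ => Subtype.ext (by simp))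
    (fun _ _ _ => Subtype.ext (by simp)) (fun _ _ _ => Subtype.ext (by simp))
  bracket_grading α β x y hx hy := L.bracket_grading α β x.1 y.1 hx hy
  super_skew α β x y hx hy := Subtype.ext (L.super_skew α β x.1 y.1 hx hy)
  super_jacobi α β x y hx hy z := Subtype.ext (L.super_jacobi α β x.1 y.1 hx hy z.1)
  bracket_self_even x hx := Subtype.ext (L.bracket_self_even x.1 hx)

/-- The inclusion of a sub-Lie-superalgebra. -/
def LieSuperalgebra.restrictIncl (L : LieSuperalgebra K) (S : Submodule K L.carrier)
    (hgr : S ≤ ⨆ α, S ⊓ L.grading α) (hbr : ∀ x ∈ S, ∀ y ∈ S, L.bracket x y ∈ S) :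
    LieSuperHom (L.restrict S hgr hbr) L where
  toLinear := S.subtype
  map_grading _ _ hx := hx
  map_bracket _ _ := rfl

/-- The identity homomorphism of a Lie superalgebra. -/
def LieSuperHom.id (L : LieSuperalgebra K) : LieSuperHom L L where
  toLinear := LinearMap.id
  map_grading _ _ hx := hx
  map_bracket _ _ := rfl

/-- Composition of homomorphisms of Lie superalgebras. -/
def LieSuperHom.comp {L M N : LieSuperalgebra K} (g : LieSuperHom M N) (f : LieSuperHom L M) :
    LieSuperHom L N where
  toLinear := g.toLinear ∘ₗ f.toLinear
  map_grading α x hx := g.map_grading α _ (f.map_grading α x hx)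
  map_bracket x y := by simp [f.map_bracket, g.map_bracket]

theorem LieSuperalgebra.iSup_grading (L : LieSuperalgebra K) : ⨆ α, L.grading α = ⊤ :=
  L.isInternal.submodule_iSup_eq_top

theorem LieSuperalgebra.eq_zero_of_mem_grading (L : LieSuperalgebra K) {α β : ZMod 2}
    (h : α ≠ β) {x : L.carrier} (hα : x ∈ L.grading α) (hβ : x ∈ L.grading β) : x = 0 :=
  Submodule.disjoint_def.1 (L.isInternal.submodule_iSupIndep.pairwiseDisjoint h) x hα hβ

namespace TensorData

variable {M N : LieSuperalgebra K} {aMN : LieSuperAction M N} {aNM : LieSuperAction N M}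
  {T : LieSuperalgebra K}

/-- Corestriction of tensor symbols to a sub-Lie-superalgebra containing them. -/
def corestrict (ι : TensorData aMN aNM T) (S : Submodule K T.carrier)
    (hgr : S ≤ ⨆ α, S ⊓ T.grading α) (hbr : ∀ x ∈ S, ∀ y ∈ S, T.bracket x y ∈ S)
    (hι : ∀ α β m n, ι.pair α β m n ∈ S) : TensorData aMN aNM (T.restrict S hgr hbr) where
  pair α β m n := ⟨ι.pair α β m n, hι α β m n⟩
  pair_grading := ι.pair_grading
  pair_smul_left α β c m n := Subtype.ext (ι.pair_smul_left α β c m n)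
  pair_smul_right α β c m n := Subtype.ext (ι.pair_smul_right α β c m n)
  pair_add_left α β m m' n := Subtype.ext (ι.pair_add_left α β m m' n)
  pair_add_right α β m n n' := Subtype.ext (ι.pair_add_right α β m n n')
  pair_bracket_left α α' β m m' n := Subtype.ext (ι.pair_bracket_left α α' β m m' n)
  pair_bracket_right α β β' m n n' := Subtype.ext (ι.pair_bracket_right α β β' m n n')
  pair_bracket_pair α β α' β' m n m' n' :=
    Subtype.ext (ι.pair_bracket_pair α β α' β' m n m' n')

theorem pair_zero_left (ι : TensorData aMN aNM T) (α β : ZMod 2) (n : N.grading β) :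
    ι.pair α β 0 n = 0 := by
  simpa using ι.pair_smul_left α β 0 0 n

theorem pair_zero_right (ι : TensorData aMN aNM T) (α β : ZMod 2) (m : M.grading α) :
    ι.pair α β m 0 = 0 := by
  simpa using ι.pair_smul_right α β 0 m 0

theorem pair_eq_zero (ι : TensorData aMN aNM T) {α β : ZMod 2} {m : M.grading α}
    (hm : m.1 = 0) (n : N.grading β) : ι.pair α β m n = 0 := by
  rw [show m = 0 from Subtype.ext hm, ι.pair_zero_left]

theorem pair_congr_left (ι : TensorData aMN aNM T) {α α' β : ZMod 2} (h : α = α')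
    {m : M.grading α} {m' : M.grading α'} (hm : m.1 = m'.1) (n : N.grading β) :
    ι.pair α β m n = ι.pair α' β m' n := by
  subst h
  rw [Subtype.ext hm]

theorem pair_zsmul_left (ι : TensorData aMN aNM T) (α β : ZMod 2) (c : ℤ) (m : M.grading α)
    (n : N.grading β) : ι.pair α β (c • m) n = c • ι.pair α β m n := by
  rw [← Int.cast_smul_eq_zsmul K, ι.pair_smul_left, Int.cast_smul_eq_zsmul]

end TensorData

theorem IsNATensor.span_pair_eq_top {M N : LieSuperalgebra K} {aMN : LieSuperAction M N}
    {aNM : LieSuperAction N M} {T : LieSuperalgebra K} {ι : TensorData aMN aNM T}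
    (hT : IsNATensor aMN aNM T ι) :
    Submodule.span K {t | ∃ α β m n, t = ι.pair α β m n} = ⊤ := by
  set S := Submodule.span K {t | ∃ α β m n, t = ι.pair α β m n} with hS
  have hι : ∀ α β m n, ι.pair α β m n ∈ S := fun α β m n =>
    Submodule.subset_span ⟨α, β, m, n, rfl⟩
  have hgr : S ≤ ⨆ α, S ⊓ T.grading α := by
    refine span_le_iSup_inf ?_
    rintro _ ⟨α, β, m, n, rfl⟩
    exact ⟨_, ι.pair_grading α β m n⟩
  have hmap : Submodule.map₂ T.bracket S S ≤ S := by
    conv_lhs => rw [hS, Submodule.map₂_span_span]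
    refine Submodule.span_le.2 ?_
    rintro _ ⟨_, ⟨α, β, m, n, rfl⟩, _, ⟨α', β', m', n', rfl⟩, rfl⟩
    simp only [SetLike.mem_coe, ι.pair_bracket_pair]
    exact S.neg_mem (zsmul_mem (hι _ _ _ _) _)
  have hbr : ∀ x ∈ S, ∀ y ∈ S, T.bracket x y ∈ S := fun x hx y hy =>
    hmap (Submodule.apply_mem_map₂ _ hx hy)
  obtain ⟨f, hf, -⟩ := hT _ (ι.corestrict S hgr hbr hι)
  have hid : (T.restrictIncl S hgr hbr).comp f = LieSuperHom.id T :=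
    (hT T ι).unique (fun α β m n => congrArg Subtype.val (hf α β m n)) fun _ _ _ _ => rfl
  refine eq_top_iff.2 fun x _ => ?_
  have hx : ((T.restrictIncl S hgr hbr).comp f).toLinear x = x := by rw [hid]; rfl
  rw [← hx]
  exact (f.toLinear x).2


/-- For crossed `P`-modules `(M,∂)` and `(N,∂′)` acting on each other
via `P`, the submodule `M □ N` of `M ⊗ N` generated by the elements
`m ⊗ n + (−1)^{|m′||n′|} m′ ⊗ n′` (with `∂m = ∂′n′`, `∂m′ = ∂′n`) and `m₀ ⊗ n₀`
(`m₀, n₀` even with `∂m₀ = ∂′n₀`) is a graded ideal contained in the centre of `M ⊗ N`. -/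
theorem statement16 {K : Type} [CommRing K] (P M N : LieSuperalgebra K)
    (cmM : CrossedModule M P) (cmN : CrossedModule N P)
    -- the actions of M and N on each other via P
    (aMN : LieSuperAction M N) (aNM : LieSuperAction N M)
    (haMN : ∀ (m : M.carrier) (n : N.carrier),
      aMN.act m n = cmN.act.act (cmM.d.toLinear m) n)
    (haNM : ∀ (n : N.carrier) (m : M.carrier),
      aNM.act n m = cmM.act.act (cmN.d.toLinear n) m)
    -- `(T, ι)` is the non-abelian tensor product `M ⊗ N`
    (T : LieSuperalgebra K) (ι : TensorData aMN aNM T) (hT : IsNATensor aMN aNM T ι)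
    -- the submodule `M □ N`
    (sq : Submodule K T.carrier)
    (hsq : sq = Submodule.span K
      ({t | ∃ (α β α' β' : ZMod 2) (m : M.grading α) (n : N.grading β)
          (m' : M.grading α') (n' : N.grading β'),
        cmM.d.toLinear m.1 = cmN.d.toLinear n'.1 ∧
        cmM.d.toLinear m'.1 = cmN.d.toLinear n.1 ∧
        t = ι.pair α β m n + ssign α' β' • ι.pair α' β' m' n'} ∪
       {t | ∃ (m₀ : M.grading 0) (n₀ : N.grading 0),
        cmM.d.toLinear m₀.1 = cmN.d.toLinear n₀.1 ∧ t = ι.pair 0 0 m₀ n₀})) :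
    -- `M □ N` is contained in the centre of `M ⊗ N` (hence is an ideal) ...
    (∀ x ∈ sq, ∀ t : T.carrier, T.bracket t x = 0 ∧ T.bracket x t = 0) ∧
    -- ... and it is a graded submodule
    sq = ⨆ α : ZMod 2, sq ⊓ T.grading α := by
  have hact : ∀ {n : N.carrier} {m m' : M.carrier},
      cmM.d.toLinear m' = cmN.d.toLinear n → aNM.act n m = M.bracket m' m := by
    intro n m m' h
    rw [haNM, ← h, cmM.cm_peiffer]
  have hleft : ∀ x ∈ sq, ∀ t : T.carrier, T.bracket x t = 0 := by
    intro x hx t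
    have ht : t ∈ Submodule.span K {t | ∃ α β m n, t = ι.pair α β m n} := by
      rw [hT.span_pair_eq_top]
      trivial
    induction ht using Submodule.span_induction with
    | zero => simp
    | add y z _ _ hy hz => rw [map_add, hy, hz, add_zero]
    | smul c y _ hy => rw [map_smul, hy, smul_zero]
    | mem y hy =>
      obtain ⟨γ, δ, p, q, rfl⟩ := hy
      rw [hsq] at hx
      induction hx using Submodule.span_induction with
      | zero => simp
      | add y z _ _ hy hz => rw [map_add, LinearMap.add_apply, hy, hz, add_zero]
      | smul c y _ hy => rw [map_smul, LinearMap.smul_apply, hy, smul_zero]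
      | mem y hy =>
        rcases hy with ⟨α, β, α', β', m, n, m', n', h, h', rfl⟩ | ⟨m, n, h, rfl⟩
        · have hs : ssign α' β' * ssign α' β' = 1 := by
            rw [ssign, ← mul_pow]
            simp
          have hnm : aNM.act n.1 m.1 = -(ssign α' α • M.bracket m.1 m'.1) := by
            rw [hact h', M.super_skew α' α _ _ m'.2 m.2]
          have hnm' : aNM.act n'.1 m'.1 = M.bracket m.1 m'.1 := hact h
          rw [map_add, map_zsmul, LinearMap.add_apply, LinearMap.smul_apply,
            ι.pair_bracket_pair, ι.pair_bracket_pair, smul_neg, smul_smul, hs, one_smul]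
          by_cases hdeg : α = β' ∧ α' = β
          · obtain ⟨rfl, rfl⟩ := hdeg
            have hs' : ssign α α' * ssign α' α = 1 := by
              rw [ssign, ssign, mul_comm α'.val, ← mul_pow]
              simp
            rw [ι.pair_congr_left (add_comm α' α)
              (m' := (-ssign α' α) • ⟨aNM.act n'.1 m'.1,
                aNM.act_grading α α' n'.1 m'.1 n'.2 m'.2⟩)
              (by simp [hnm, hnm']), ι.pair_zsmul_left, smul_smul, mul_neg, hs']
            simp
          · have hzero : M.bracket m.1 m'.1 = 0 := by
              by_cases hα : α = β'
              · have : cmM.d.toLinear m'.1 = 0 :=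
                  P.eq_zero_of_mem_grading (fun hβ => hdeg ⟨hα, hβ⟩)
                    (cmM.d.map_grading α' _ m'.2) (h' ▸ cmN.d.map_grading β _ n.2)
                have hz : M.bracket m'.1 m.1 = 0 := by
                  rw [← cmM.cm_peiffer, this, map_zero, LinearMap.zero_apply]
                rw [M.super_skew α α' _ _ m.2 m'.2, hz, smul_zero, neg_zero]
              · have : cmM.d.toLinear m.1 = 0 :=
                  P.eq_zero_of_mem_grading hα
                    (cmM.d.map_grading α _ m.2) (h ▸ cmN.d.map_grading β' _ n'.2)
                rw [← cmM.cm_peiffer, this, map_zero, LinearMap.zero_apply]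
            rw [ι.pair_eq_zero (by simp [hnm, hzero]), ι.pair_eq_zero (by simp [hnm', hzero])]
            simp
        · rw [ι.pair_bracket_pair, ι.pair_eq_zero]
          · simp
          · exact (hact h).trans (M.bracket_self_even m.1 m.2)
  have hgraded : sq ≤ ⨆ α : ZMod 2, sq ⊓ T.grading α := by
    conv_lhs => rw [hsq]
    refine Submodule.span_le.2 ?_
    rintro t ht
    have htsq : t ∈ sq := hsq ▸ Submodule.subset_span ht
    rcases ht with ⟨α, β, α', β', m, n, m', n', h, h', rfl⟩ | ⟨m, n, h, rfl⟩
    · by_cases hdeg : α = β' ∧ α' = β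
      · obtain ⟨rfl, rfl⟩ := hdeg
        refine Submodule.mem_iSup_of_mem (α + α') ⟨htsq, ?_⟩
        refine add_mem (ι.pair_grading _ _ _ _) (zsmul_mem ?_ _)
        rw [add_comm]
        exact ι.pair_grading _ _ _ _
      · have hmem : ι.pair α β m n ∈ sq := by
          rw [hsq]
          refine Submodule.subset_span (Or.inl ?_)
          by_cases hα : α = β'
          · have h0 : cmM.d.toLinear m'.1 = 0 :=
              P.eq_zero_of_mem_grading (fun hβ => hdeg ⟨hα, hβ⟩)
                (cmM.d.map_grading α' _ m'.2) (h' ▸ cmN.d.map_grading β _ n.2)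
            exact ⟨α, β, α', β', m, n, 0, n', h, by simp [← h', h0],
              by simp [ι.pair_zero_left]⟩
          · have h0 : cmM.d.toLinear m.1 = 0 :=
              P.eq_zero_of_mem_grading hα
                (cmM.d.map_grading α _ m.2) (h ▸ cmN.d.map_grading β' _ n'.2)
            exact ⟨α, β, α', β', m, n, m', 0, by simp [h0], h', by simp [ι.pair_zero_right]⟩
        refine add_mem (Submodule.mem_iSup_of_mem (α + β) ⟨hmem, ι.pair_grading _ _ _ _⟩)
          (Submodule.mem_iSup_of_mem (α' + β') ⟨?_, zsmul_mem (ι.pair_grading _ _ _ _) _⟩)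
        exact (Submodule.add_mem_iff_right _ hmem).1 htsq
    · exact Submodule.mem_iSup_of_mem _ ⟨htsq, ι.pair_grading _ _ _ _⟩
  refine ⟨fun x hx t => ⟨?_, hleft x hx t⟩,
    le_antisymm hgraded (iSup_le fun _ => inf_le_left)⟩
  have ht : t ∈ ⨆ α, T.grading α := by
    rw [T.iSup_grading]
    trivial
  refine Submodule.iSup_induction _ (motive := fun x => T.bracket t x = 0) (hgraded hx)
    (fun α y hy => ?_) (map_zero _) fun y z hy hz => by rw [map_add, hy, hz, add_zero]
  refine Submodule.iSup_induction _ (motive := fun t => T.bracket t y = 0) ht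
    (fun β s hs => ?_) (by simp) fun s s' h h' => by
      rw [map_add, LinearMap.add_apply, h, h', add_zero]
  rw [T.super_skew β α s y hs hy.2, hleft y hy.1, smul_zero, neg_zero]

end SuperNA
end
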